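/- arXiv:2210.02711 — 4 statements merged into one kernel-verified Lean document; each statement's English description precedes it below -/
import Mathlib

section
/- There exists a locally finite graph that is not ubiquitous with respect to the minor relation; concretely, the graph H (the disjoint union of the 1-sum of K₅ and K₃,₃ with a ray) is locally finite but not ubiquitous. -/
open SimpleGraph

/-- A model (inflated copy) of `X` in `G`: pairwise disjoint nonempty connected branch
sets `B v`, one for each vertex `v` of `X`, such that for every edge `v w` of `X` there is
an edge of `G` between `B v` and `B w`. -/
structure IsMinorModel {α β : Type*} (X : SimpleGraph α) (G : SimpleGraph β)
    (B : α → Set β) : Prop where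
  nonempty : ∀ v, (B v).Nonempty
  connected : ∀ v, (G.induce (B v)).Connected
  pairwise_disjoint : ∀ ⦃v w⦄, v ≠ w → Disjoint (B v) (B w)
  adj : ∀ ⦃v w⦄, X.Adj v w → ∃ x ∈ B v, ∃ y ∈ B w, G.Adj x y

/-- An `ι`-indexed family of pairwise vertex-disjoint models of `X` in `G`. -/
def DisjointModels {α β ι : Type*} (X : SimpleGraph α) (G : SimpleGraph β)
    (B : ι → α → Set β) : Prop :=
  (∀ k, IsMinorModel X G (B k)) ∧
    ∀ ⦃k l⦄, k ≠ l → Disjoint (⋃ v, B k v) (⋃ v, B l v)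

/-- `X` is ubiquitous (w.r.t. the minor relation): every graph containing `n` pairwise
vertex-disjoint `X`-minors for every `n` contains infinitely many pairwise
vertex-disjoint `X`-minors. -/
def Ubiquitous {α : Type*} (X : SimpleGraph α) : Prop :=
  ∀ ⦃β : Type⦄ (G : SimpleGraph β),
    (∀ n : ℕ, ∃ B : Fin n → α → Set β, DisjointModels X G B) →
    ∃ B : ℕ → α → Set β, DisjointModels X G B

/-- The ray: the one-way infinite path on `ℕ`. -/
def Ray : SimpleGraph ℕ := SimpleGraph.fromRel (fun n m => m = n + 1)

/-- The complete graph `K₅`. -/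
abbrev K5 : SimpleGraph (Fin 5) := ⊤

/-- The complete bipartite graph `K₃,₃`. -/
abbrev K33 : SimpleGraph (Fin 3 ⊕ Fin 3) := completeBipartiteGraph (Fin 3) (Fin 3)

/-- Vertices of the 1-sum `I` of `K₅` and `K₃,₃`: the five vertices of `K₅` (with
`Sum.inl 0` the identified vertex, which is also a vertex of the left side of `K₃,₃`),
plus the two remaining left-side vertices and the three right-side vertices of `K₃,₃`. -/
abbrev IV : Type := Fin 5 ⊕ (Fin 2 ⊕ Fin 3)

def IRel : IV → IV → Prop
  | Sum.inl _, Sum.inl _ => True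
  | Sum.inl i, Sum.inr (Sum.inr _) => i = 0
  | Sum.inr (Sum.inl _), Sum.inr (Sum.inr _) => True
  | _, _ => False

/-- The graph `I`: the 1-sum of `K₅` and `K₃,₃`, identifying one vertex of each. -/
def GraphI : SimpleGraph IV := SimpleGraph.fromRel IRel

/-- The graph `H`: the disjoint union of `I` and a ray. -/
def GraphH : SimpleGraph (IV ⊕ ℕ) := GraphI ⊕g Ray

def GridRel (p q : ℤ × ℕ) : Prop :=
  (q.1 = p.1 + 1 ∧ q.2 = p.2) ∨ (q.1 = p.1 ∧ q.2 = p.2 + 1)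

/-- The half-grid on `ℤ × ℕ`: vertices adjacent iff they differ by exactly `1` in one
coordinate and agree in the other. -/
def HalfGrid : SimpleGraph (ℤ × ℕ) := SimpleGraph.fromRel GridRel

abbrev NegInt : Type := {a : ℤ // a < 0}
abbrev NonnegInt : Type := {b : ℤ // 0 ≤ b}

/-- Vertices of `G`: the half-grid vertices, plus for each `a < 0` four new vertices
(completing the `K₅` attached at `(a,0)`), plus for each `b ≥ 0` five new vertices
(completing the `K₃,₃` attached at `(b,0)`; the new vertices `0, 1` together with
`(b,0)` form the left side and the new vertices `2, 3, 4` form the right side). -/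
abbrev GV : Type := (ℤ × ℕ) ⊕ ((NegInt × Fin 4) ⊕ (NonnegInt × Fin 5))

def GRel : GV → GV → Prop
  | Sum.inl p, Sum.inl q => GridRel p q
  | Sum.inl p, Sum.inr (Sum.inl w) => p = (w.1.1, 0)
  | Sum.inl p, Sum.inr (Sum.inr w) => p = (w.1.1, 0) ∧ 2 ≤ (w.2 : ℕ)
  | Sum.inr (Sum.inl w), Sum.inr (Sum.inl w') => w.1 = w'.1
  | Sum.inr (Sum.inr w), Sum.inr (Sum.inr w') => w.1 = w'.1 ∧ (w.2 : ℕ) < 2 ∧ 2 ≤ (w'.2 : ℕ)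
  | _, _ => False

/-- The graph `G`: the half-grid with a `K₅` attached at each `(a,0)`, `a < 0`, and a
`K₃,₃` attached at each `(b,0)`, `b ≥ 0`. -/
def GraphG : SimpleGraph GV := SimpleGraph.fromRel GRel

/-- The vertex set of the attached copy of `K₅` at `(a, 0)`. -/
def K5copy (a : NegInt) : Set GV :=
  {Sum.inl (a.1, 0)} ∪ {x | ∃ i : Fin 4, x = Sum.inr (Sum.inl (a, i))}

/-- The vertex set of the attached copy of `K₃,₃` at `(b, 0)`. -/
def K33copy (b : NonnegInt) : Set GV :=
  {Sum.inl (b.1, 0)} ∪ {x | ∃ i : Fin 5, x = Sum.inr (Sum.inr (b, i))}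


namespace GridUbiquity

/-! ### Sums over the darts of a walk -/

section WalkSum

variable {V : Type*} {G : SimpleGraph V}

/-- The sum modulo `2` of `f` over the darts of a walk. -/
def walkSum (f : V → V → ZMod 2) : ∀ {u v : V}, G.Walk u v → ZMod 2
  | _, _, .nil => 0
  | _, _, .cons (u := u) (v := v) _ p => f u v + walkSum f p

@[simp] lemma walkSum_nil (f : V → V → ZMod 2) (u : V) :
    walkSum f (Walk.nil : G.Walk u u) = 0 := rfl

@[simp] lemma walkSum_cons (f : V → V → ZMod 2) {u v w : V} (h : G.Adj u v) (p : G.Walk v w) :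
    walkSum f (Walk.cons h p) = f u v + walkSum f p := rfl

lemma walkSum_append (f : V → V → ZMod 2) {u v w : V} (p : G.Walk u v) (q : G.Walk v w) :
    walkSum f (p.append q) = walkSum f p + walkSum f q := by
  induction p with
  | nil => simp
  | cons h p ih => simp [ih, add_assoc]

lemma walkSum_reverse {f : V → V → ZMod 2} (hf : ∀ u v, f u v = f v u) {u v : V}
    (p : G.Walk u v) : walkSum f p.reverse = walkSum f p := by
  induction p with
  | nil => simp
  | cons h p ih => simp [walkSum_append, ih, hf, add_comm]

lemma walkSum_add (f g : V → V → ZMod 2) {u v : V} (p : G.Walk u v) :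
    walkSum (fun a b => f a b + g a b) p = walkSum f p + walkSum g p := by
  induction p with
  | nil => simp
  | cons h p ih => simp only [walkSum_cons, ih]; ring

lemma walkSum_congr {f g : V → V → ZMod 2} {u v : V} (p : G.Walk u v)
    (h : ∀ a ∈ p.support, ∀ b ∈ p.support, G.Adj a b → f a b = g a b) :
    walkSum f p = walkSum g p := by
  induction p with
  | nil => simp
  | cons hab p ih =>
    rw [walkSum_cons, walkSum_cons, h _ (by simp) _ (by simp) hab,
      ih fun a ha b hb => h a (by simp [ha]) b (by simp [hb])]

lemma walkSum_eq_zero {f : V → V → ZMod 2} {u v : V} (p : G.Walk u v)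
    (h : ∀ a ∈ p.support, ∀ b ∈ p.support, G.Adj a b → f a b = 0) :
    walkSum f p = 0 := by
  induction p with
  | nil => simp
  | cons hab p ih =>
    rw [walkSum_cons, h _ (by simp) _ (by simp) hab,
      ih fun a ha b hb => h a (by simp [ha]) b (by simp [hb]), add_zero]

/-- Telescoping: a coboundary sums to the difference of its values at the two ends. -/
lemma walkSum_coboundary (g : V → ZMod 2) {u v : V} (p : G.Walk u v) :
    walkSum (fun a b => g a + g b) p = g u + g v := by
  induction p with
  | nil => simp [CharTwo.add_self_eq_zero]
  | cons h p ih => rw [walkSum_cons, ih]; grind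

end WalkSum

/-! ### Crossing numbers modulo `2` in the half-grid -/

lemma halfGrid_adj {p q : ℤ × ℕ} : HalfGrid.Adj p q ↔ GridRel p q ∨ GridRel q p := by
  simp only [HalfGrid, fromRel_adj, GridRel, ne_eq, Prod.ext_iff, and_iff_right_iff_imp]
  omega

/-- Parity of the number of crossings of the edge `a b`, shifted by `(1/2, 1/2)`, with the
upward vertical ray from `v`. -/
def rayCross (v a b : ℤ × ℕ) : ZMod 2 :=
  if a.2 = b.2 ∧ v.2 ≤ a.2 ∧ max a.1 b.1 = v.1 then 1 else 0

/-- Parity of the number of crossings of the edge `a b` with the edge `c d` shifted by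
`(1/2, 1/2)`. -/
def edgeCross (a b c d : ℤ × ℕ) : ZMod 2 :=
  if (a.2 = b.2 ∧ c.1 = d.1 ∧ max c.2 d.2 = a.2 ∧ min a.1 b.1 = c.1) ∨
    (a.1 = b.1 ∧ c.2 = d.2 ∧ min a.2 b.2 = c.2 ∧ max c.1 d.1 = a.1) then 1 else 0

/-- Indicator of `a b` being the edge going right or the edge going down from `v`. -/
def rightDown (v a b : ℤ × ℕ) : ZMod 2 :=
  if (a.2 = b.2 ∧ a.2 = v.2 ∧ min a.1 b.1 = v.1) ∨
    (a.1 = b.1 ∧ a.1 = v.1 ∧ max a.2 b.2 = v.2) then 1 else 0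

/-- Indicator of the equality of two vertices. -/
def same (a b : ℤ × ℕ) : ZMod 2 := if a = b then 1 else 0

/-- If `a b` is horizontal, the indicator of `v` lying on the vertical ray above the left end
of `a b`. -/
def above (a b v : ℤ × ℕ) : ZMod 2 :=
  if a.2 = b.2 ∧ v.1 = min a.1 b.1 ∧ a.2 ≤ v.2 then 1 else 0

lemma rayCross_symm (v a b : ℤ × ℕ) : rayCross v a b = rayCross v b a := by
  unfold rayCross; exact if_congr (by omega) rfl rfl

lemma edgeCross_symm_left (a b c d : ℤ × ℕ) : edgeCross a b c d = edgeCross b a c d := by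
  unfold edgeCross; exact if_congr (by omega) rfl rfl

lemma edgeCross_symm_right (a b c d : ℤ × ℕ) : edgeCross a b c d = edgeCross a b d c := by
  unfold edgeCross; exact if_congr (by omega) rfl rfl

lemma rightDown_symm (v a b : ℤ × ℕ) : rightDown v a b = rightDown v b a := by
  unfold rightDown; exact if_congr (by omega) rfl rfl

lemma above_symm (a b v : ℤ × ℕ) : above a b v = above b a v := by
  unfold above; exact if_congr (by omega) rfl rfl

/-- A symmetric statement about grid edges need only be checked for one orientation. -/
lemma of_gridRel {P : ℤ × ℕ → ℤ × ℕ → Prop} (hs : ∀ a b, P a b → P b a)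
    (h : ∀ a b, GridRel a b → P a b) {a b : ℤ × ℕ} (hab : HalfGrid.Adj a b) : P a b :=
  (halfGrid_adj.1 hab).elim (h a b) fun hba => hs _ _ (h b a hba)

lemma rayCross_add_rayCross {a b c d : ℤ × ℕ} (hab : HalfGrid.Adj a b) (hcd : HalfGrid.Adj c d) :
    rayCross a c d + rayCross b c d = edgeCross a b c d + (above a b c + above a b d) := by
  revert hcd
  refine of_gridRel (P := fun a b => HalfGrid.Adj c d → rayCross a c d + rayCross b c d =
    edgeCross a b c d + (above a b c + above a b d)) ?_ ?_ hab
  · intro a b h hcd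
    rw [add_comm, h hcd, edgeCross_symm_left, above_symm, above_symm a b]
  intro a b hab
  refine of_gridRel (P := fun c d => rayCross a c d + rayCross b c d =
    edgeCross a b c d + (above a b c + above a b d)) ?_ ?_
  · intro c d h
    rw [rayCross_symm, rayCross_symm b, h, edgeCross_symm_right, add_comm (above a b c)]
  rintro c d hcd
  obtain ⟨a1, a2⟩ := a; obtain ⟨b1, b2⟩ := b; obtain ⟨c1, c2⟩ := c; obtain ⟨d1, d2⟩ := d
  simp only [GridRel] at hab hcd
  simp only [rayCross, edgeCross, above]
  obtain ⟨rfl, rfl⟩ | ⟨rfl, rfl⟩ := hab <;> obtain ⟨rfl, rfl⟩ | ⟨rfl, rfl⟩ := hcd <;>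
  split_ifs <;> first | omega | decide

lemma same_comm (a b : ℤ × ℕ) : same a b = same b a := if_congr eq_comm rfl rfl

lemma same_eq_same {a b c d : ℤ × ℕ} (h : a.1 = b.1 ∧ a.2 = b.2 ↔ c.1 = d.1 ∧ c.2 = d.2) :
    same a b = same c d :=
  if_congr (by simpa only [Prod.ext_iff] using h) rfl rfl

lemma rightDown_of_horizontal {v a b : ℤ × ℕ} (h : b.1 = a.1 + 1 ∧ b.2 = a.2) :
    rightDown v a b = same v a :=
  if_congr (by rw [Prod.ext_iff]; omega) rfl rfl

lemma rightDown_of_vertical {v a b : ℤ × ℕ} (h : b.1 = a.1 ∧ b.2 = a.2 + 1) :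
    rightDown v a b = same v b :=
  if_congr (by rw [Prod.ext_iff]; omega) rfl rfl

lemma edgeCross_of_horizontal {a b c d : ℤ × ℕ} (hab : b.1 = a.1 + 1 ∧ b.2 = a.2)
    (hcd : d.1 = c.1 + 1 ∧ d.2 = c.2) : edgeCross a b c d = 0 :=
  if_neg (by omega)

lemma edgeCross_of_vertical {a b c d : ℤ × ℕ} (hab : b.1 = a.1 ∧ b.2 = a.2 + 1)
    (hcd : d.1 = c.1 ∧ d.2 = c.2 + 1) : edgeCross a b c d = 0 :=
  if_neg (by omega)

lemma edgeCross_of_horizontal_vertical {a b c d : ℤ × ℕ} (hab : b.1 = a.1 + 1 ∧ b.2 = a.2)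
    (hcd : d.1 = c.1 ∧ d.2 = c.2 + 1) : edgeCross a b c d = same a d :=
  if_congr (by rw [Prod.ext_iff]; omega) rfl rfl

lemma edgeCross_of_vertical_horizontal {a b c d : ℤ × ℕ} (hab : b.1 = a.1 ∧ b.2 = a.2 + 1)
    (hcd : d.1 = c.1 + 1 ∧ d.2 = c.2) : edgeCross a b c d = same a d :=
  if_congr (by rw [Prod.ext_iff]; omega) rfl rfl

lemma edgeCross_add_edgeCross {a b c d : ℤ × ℕ} (hab : HalfGrid.Adj a b)
    (hcd : HalfGrid.Adj c d) :
    edgeCross a b c d + edgeCross c d a b =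
      rightDown c a b + rightDown d a b + (rightDown a c d + rightDown b c d) +
      (same a c + same a d + (same b c + same b d)) := by
  revert hcd
  refine of_gridRel (P := fun a b => HalfGrid.Adj c d → edgeCross a b c d + edgeCross c d a b =
      rightDown c a b + rightDown d a b + (rightDown a c d + rightDown b c d) +
      (same a c + same a d + (same b c + same b d))) ?_ ?_ hab
  · intro a b h hcd
    rw [edgeCross_symm_left, edgeCross_symm_right c, h hcd, rightDown_symm c, rightDown_symm d]
    ring
  intro a b hab
  refine of_gridRel (P := fun c d => edgeCross a b c d + edgeCross c d a b =
      rightDown c a b + rightDown d a b + (rightDown a c d + rightDown b c d) +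
      (same a c + same a d + (same b c + same b d))) ?_ ?_
  · intro c d h
    rw [edgeCross_symm_left d, edgeCross_symm_right _ _ d, h, rightDown_symm a, rightDown_symm b]
    ring
  rintro c d hcd
  rw [same_comm a c, same_comm a d, same_comm b c, same_comm b d]
  rcases hab with hab | hab <;> rcases hcd with hcd | hcd
  · rw [rightDown_of_horizontal hab, rightDown_of_horizontal hab, rightDown_of_horizontal hcd,
      rightDown_of_horizontal hcd, edgeCross_of_horizontal hab hcd,
      edgeCross_of_horizontal hcd hab, same_comm a c, same_comm b c,
      same_eq_same (a := d) (b := b) (c := c) (d := a) (by omega)]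
    grind [same_comm]
  · rw [rightDown_of_horizontal hab, rightDown_of_horizontal hab, rightDown_of_vertical hcd,
      rightDown_of_vertical hcd, edgeCross_of_horizontal_vertical hab hcd,
      edgeCross_of_vertical_horizontal hcd hab]
    grind [same_comm]
  · rw [rightDown_of_vertical hab, rightDown_of_vertical hab, rightDown_of_horizontal hcd,
      rightDown_of_horizontal hcd, edgeCross_of_vertical_horizontal hab hcd,
      edgeCross_of_horizontal_vertical hcd hab]
    grind [same_comm]
  · rw [rightDown_of_vertical hab, rightDown_of_vertical hab, rightDown_of_vertical hcd,
      rightDown_of_vertical hcd, edgeCross_of_vertical hab hcd,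
      edgeCross_of_vertical hcd hab,
      same_eq_same (a := c) (b := a) (c := d) (d := b) (by omega)]
    grind [same_comm]

lemma edgeCross_eq_zero {a b c d : ℤ × ℕ}
    (hac : a ≠ c) (had : a ≠ d) (hbc : b ≠ c) (hbd : b ≠ d) : edgeCross a b c d = 0 := by
  simp only [ne_eq, Prod.ext_iff] at hac had hbc hbd
  rw [edgeCross, if_neg]
  omega

lemma rightDown_eq_zero {v a b : ℤ × ℕ} (hva : v ≠ a) (hvb : v ≠ b) : rightDown v a b = 0 := by
  simp only [ne_eq, Prod.ext_iff] at hva hvb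
  rw [rightDown, if_neg]
  omega

/-- Parity of the number of crossings of the walk `p` with the walk `q` shifted by
`(1/2, 1/2)`. -/
def walkCross {s t u v : ℤ × ℕ} (p : HalfGrid.Walk s t) (q : HalfGrid.Walk u v) : ZMod 2 :=
  walkSum (fun a b => walkSum (edgeCross a b) q) p

section WalkCross

variable {s t r u v w : ℤ × ℕ}

lemma walkCross_append_left (p : HalfGrid.Walk s t) (p' : HalfGrid.Walk t r)
    (q : HalfGrid.Walk u v) : walkCross (p.append p') q = walkCross p q + walkCross p' q :=
  walkSum_append _ _ _

lemma walkCross_append_right (p : HalfGrid.Walk s t) (q : HalfGrid.Walk u v)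
    (q' : HalfGrid.Walk v w) : walkCross p (q.append q') = walkCross p q + walkCross p q' := by
  simp only [walkCross, walkSum_append, walkSum_add]

lemma walkCross_reverse_left (p : HalfGrid.Walk s t) (q : HalfGrid.Walk u v) :
    walkCross p.reverse q = walkCross p q :=
  walkSum_reverse (f := fun a b => walkSum (edgeCross a b) q)
    (fun a b => walkSum_congr _ fun _ _ _ _ _ => edgeCross_symm_left a b _ _) _

lemma walkCross_reverse_right (p : HalfGrid.Walk s t) (q : HalfGrid.Walk u v) :
    walkCross p q.reverse = walkCross p q := by
  simp only [walkCross, walkSum_reverse (edgeCross_symm_right _ _)]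

lemma walkCross_eq_zero_of_disjoint {p : HalfGrid.Walk s t} {q : HalfGrid.Walk u v}
    (h : ∀ x ∈ p.support, x ∉ q.support) : walkCross p q = 0 :=
  walkSum_eq_zero _ fun a ha b hb _ => walkSum_eq_zero _ fun _ hc _ hd _ =>
    edgeCross_eq_zero (fun e => h a ha (e ▸ hc)) (fun e => h a ha (e ▸ hd))
      (fun e => h b hb (e ▸ hc)) (fun e => h b hb (e ▸ hd))

lemma walkSum_rayCross_add (p : HalfGrid.Walk s t) {a b : ℤ × ℕ} (hab : HalfGrid.Adj a b) :
    walkSum (rayCross a) p + walkSum (rayCross b) p =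
      walkSum (edgeCross a b) p + (above a b s + above a b t) := by
  rw [← walkSum_coboundary (above a b) p, ← walkSum_add, ← walkSum_add]
  exact walkSum_congr _ fun c _ d _ hcd => rayCross_add_rayCross hab hcd

/-- Two closed walks cross an even number of times. -/
lemma walkCross_closed (p : HalfGrid.Walk s s) (q : HalfGrid.Walk u u) : walkCross p q = 0 := by
  have h : walkCross p q =
      walkSum (fun a b => walkSum (rayCross a) q + walkSum (rayCross b) q) p :=
    walkSum_congr _ fun a _ b _ hab => by
      rw [walkSum_rayCross_add q hab, CharTwo.add_self_eq_zero, add_zero]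
  rw [h, walkSum_coboundary (fun a => walkSum (rayCross a) q), CharTwo.add_self_eq_zero]

/-- The failure of `walkCross` to be symmetric is concentrated at the ends of the walks. -/
lemma walkCross_add_walkCross (p : HalfGrid.Walk s t) (q : HalfGrid.Walk u v) :
    walkCross p q + walkCross q p =
      walkSum (rightDown u) p + walkSum (rightDown v) p +
      (walkSum (rightDown s) q + walkSum (rightDown t) q) +
      (same s u + same s v + (same t u + same t v)) := by
  have hswap : walkCross q p = walkSum (fun a b => walkSum (fun c d => edgeCross c d a b) q) p := by
    induction p with
    | nil => exact walkSum_eq_zero _ fun _ _ _ _ _ => rfl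
    | cons h p ih =>
      rw [walkSum_cons, ← ih]
      exact walkSum_add _ _ _
  have hedge : ∀ a b, HalfGrid.Adj a b →
      walkSum (edgeCross a b) q + walkSum (fun c d => edgeCross c d a b) q =
      rightDown u a b + rightDown v a b +
        ((walkSum (rightDown a) q + (same a u + same a v)) +
          (walkSum (rightDown b) q + (same b u + same b v))) := by
    intro a b hab
    rw [← walkSum_add, walkSum_congr (g := fun c d => (rightDown c a b + rightDown d a b) +
      ((rightDown a c d + rightDown b c d) + ((same a c + same a d) + (same b c + same b d)))) q
      fun c _ d _ hcd => by rw [edgeCross_add_edgeCross hab hcd]; ring]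
    rw [walkSum_add, walkSum_coboundary (fun c => rightDown c a b), walkSum_add, walkSum_add,
      walkSum_add, walkSum_coboundary (same a), walkSum_coboundary (same b)]
    ring
  rw [hswap, walkCross, ← walkSum_add, walkSum_congr _ fun a _ b _ hab => hedge a b hab,
    walkSum_add, walkSum_add,
    walkSum_coboundary (fun a => walkSum (rightDown a) q + (same a u + same a v))]
  ring

/-- Antisymmetry defect of two walks with a common start. -/
lemma walkCross_add_walkCross_of_common_start {p : HalfGrid.Walk s t} {q : HalfGrid.Walk s u}
    (ht : t ∉ q.support) (hu : u ∉ p.support) :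
    walkCross p q + walkCross q p = 1 + walkSum (rightDown s) p + walkSum (rightDown s) q := by
  have hsu : s ≠ u := fun h => hu (h ▸ p.start_mem_support)
  have hts : t ≠ s := fun h => ht (h ▸ q.start_mem_support)
  have htu : t ≠ u := fun h => ht (h ▸ q.end_mem_support)
  rw [walkCross_add_walkCross,
    walkSum_eq_zero (f := rightDown u) p fun a ha b hb _ =>
      rightDown_eq_zero (fun h => hu (h ▸ ha)) (fun h => hu (h ▸ hb)),
    walkSum_eq_zero (f := rightDown t) q fun a ha b hb _ =>
      rightDown_eq_zero (fun h => ht (h ▸ ha)) (fun h => ht (h ▸ hb))]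
  simp only [same, if_neg hsu, if_neg hts, if_neg htu, if_true]
  ring

/-- Among the pairs of three walks leaving a common vertex, the total antisymmetry defect is
odd. -/
lemma star_crossing {p : HalfGrid.Walk s t} {q : HalfGrid.Walk s u} {m : HalfGrid.Walk s v}
    (htq : t ∉ q.support) (htm : t ∉ m.support) (hup : u ∉ p.support) (hum : u ∉ m.support)
    (hvp : v ∉ p.support) (hvq : v ∉ q.support) :
    (walkCross p q + walkCross q p) + (walkCross p m + walkCross m p) +
      (walkCross q m + walkCross m q) = 1 := by
  rw [walkCross_add_walkCross_of_common_start htq hup,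
    walkCross_add_walkCross_of_common_start htm hvp,
    walkCross_add_walkCross_of_common_start hum hvq]
  grind

end WalkCross

/-! ### The half-grid contains neither a `K₅`-minor nor a `K₃,₃`-minor -/

section Minors

variable {α V : Type*} {X : SimpleGraph α} {G : SimpleGraph V} {B : α → Set V}

/-- Any two vertices of `S` are joined by a walk of `G` inside `S`. -/
def Linked (G : SimpleGraph V) (S : Set V) : Prop :=
  ∀ ⦃u⦄, u ∈ S → ∀ ⦃v⦄, v ∈ S → ∃ p : G.Walk u v, ∀ x ∈ p.support, x ∈ S

lemma linked_of_connected {S : Set V} (hS : (G.induce S).Connected) : Linked G S := by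
  intro u hu v hv
  obtain ⟨p⟩ := hS.preconnected ⟨u, hu⟩ ⟨v, hv⟩
  refine ⟨p.map (Embedding.induce S).toHom, fun x hx => ?_⟩
  have hx' : x ∈ (p.map (Embedding.induce S).toHom).support := hx
  obtain ⟨y, -, rfl⟩ := List.mem_map.1 (Walk.support_map (Embedding.induce S).toHom p ▸ hx')
  exact y.2

lemma connected_of_linked {S : Set V} (hS : Linked G S) (hne : S.Nonempty) :
    (G.induce S).Connected := by
  have := hne.to_subtype
  refine ⟨fun u v => ?_⟩
  obtain ⟨p, hp⟩ := hS u.2 v.2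
  exact ⟨p.induce S hp⟩

lemma exists_walk_of_adj (h : IsMinorModel X G B) {f : α → V} (hf : ∀ v, f v ∈ B v) {u v : α}
    (huv : X.Adj u v) : ∃ p : G.Walk (f u) (f v), ∀ x ∈ p.support, x ∈ B u ∨ x ∈ B v := by
  obtain ⟨x, hx, y, hy, hxy⟩ := h.adj huv
  obtain ⟨p, hp⟩ := linked_of_connected (h.connected u) (hf u) hx
  obtain ⟨q, hq⟩ := linked_of_connected (h.connected v) hy (hf v)
  refine ⟨p.append (Walk.cons hxy q), fun z hz => ?_⟩
  rw [Walk.mem_support_append_iff, Walk.support_cons, List.mem_cons] at hz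
  rcases hz with hz | rfl | hz
  exacts [.inl (hp z hz), .inl hx, .inr (hq z hz)]

lemma eq_of_mem_of_mem (h : IsMinorModel X G B) {u v : α} {x : V} (hu : x ∈ B u) (hv : x ∈ B v) :
    u = v :=
  by_contra fun huv => Set.disjoint_left.1 (h.pairwise_disjoint huv) hu hv

lemma isMinorModel_comp {γ : Type*} {Y : SimpleGraph γ} (h : IsMinorModel X G B) (f : γ → α)
    (hf : Function.Injective f) (hadj : ∀ ⦃v w⦄, Y.Adj v w → X.Adj (f v) (f w)) :
    IsMinorModel Y G (B ∘ f) where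
  nonempty v := h.nonempty (f v)
  connected v := h.connected (f v)
  pairwise_disjoint _ _ hvw := h.pairwise_disjoint (hf.ne hvw)
  adj _ _ hvw := h.adj (hadj hvw)

/-- The union of the branch sets of a connected graph is connected. -/
lemma linked_iUnion (h : IsMinorModel X G B) (hX : X.Preconnected) : Linked G (⋃ v, B v) := by
  suffices H : ∀ {u v : α} (_ : X.Walk u v) {x y : V}, x ∈ B u → y ∈ B v →
      ∃ p : G.Walk x y, ∀ z ∈ p.support, z ∈ ⋃ w, B w by
    intro x hx y hy
    obtain ⟨u, hu⟩ := Set.mem_iUnion.1 hx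
    obtain ⟨v, hv⟩ := Set.mem_iUnion.1 hy
    obtain ⟨p⟩ := hX u v
    exact H p hu hv
  intro u v p
  induction p with
  | @nil u =>
    intro x y hx hy
    obtain ⟨p, hp⟩ := linked_of_connected (h.connected u) hx hy
    exact ⟨p, fun z hz => Set.mem_iUnion.2 ⟨u, hp z hz⟩⟩
  | @cons u w v huw p ih =>
    intro x y hx hy
    obtain ⟨a, ha, b, hb, hab⟩ := h.adj huw
    obtain ⟨q, hq⟩ := linked_of_connected (h.connected u) hx ha
    obtain ⟨q', hq'⟩ := ih hb hy
    refine ⟨q.append (Walk.cons hab q'), fun z hz => ?_⟩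
    rw [Walk.mem_support_append_iff, Walk.support_cons, List.mem_cons] at hz
    rcases hz with hz | rfl | hz
    exacts [Set.mem_iUnion.2 ⟨u, hq z hz⟩, Set.mem_iUnion.2 ⟨u, ha⟩, hq' z hz]

end Minors

theorem not_isMinorModel_K5_halfGrid (B : Fin 5 → Set (ℤ × ℕ)) :
    ¬ IsMinorModel K5 HalfGrid B := by
  intro h
  choose f hf using h.nonempty
  have hw : ∀ u v : Fin 5, ∃ p : HalfGrid.Walk (f u) (f v),
      u ≠ v → ∀ x ∈ p.support, x ∈ B u ∨ x ∈ B v := by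
    intro u v
    by_cases huv : u = v
    · subst huv
      exact ⟨Walk.nil, fun hne => (hne rfl).elim⟩
    · obtain ⟨p, hp⟩ := exists_walk_of_adj h hf (show K5.Adj u v from huv)
      exact ⟨p, fun _ => hp⟩
  choose W hW using hw
  have hzero : ∀ u v u' v', u ≠ v → u' ≠ v' → u ≠ u' → u ≠ v' → v ≠ u' → v ≠ v' →
      walkCross (W u v) (W u' v') = 0 := by
    intro u v u' v' huv huv' h1 h2 h3 h4
    refine walkCross_eq_zero_of_disjoint fun x hx hx' => ?_
    rcases hW u v huv x hx with hx | hx <;> rcases hW u' v' huv' x hx' with hx' | hx'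
    exacts [h1 (eq_of_mem_of_mem h hx hx'), h2 (eq_of_mem_of_mem h hx hx'),
      h3 (eq_of_mem_of_mem h hx hx'), h4 (eq_of_mem_of_mem h hx hx')]
  have hnot : ∀ u v w, u ≠ v → w ≠ u → w ≠ v → f w ∉ (W u v).support := by
    intro u v w huv h1 h2 hx
    rcases hW u v huv _ hx with hx | hx
    exacts [h1 (eq_of_mem_of_mem h (hf w) hx), h2 (eq_of_mem_of_mem h (hf w) hx)]
  -- the triangles `0 b c` and `0 d e` cross only at `0`
  have htri : ∀ b c d e : Fin 5, [0, b, c, d, e].Nodup →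
      walkCross (W 0 b) (W 0 d) + walkCross (W 0 b) (W 0 e) +
        (walkCross (W 0 c) (W 0 d) + walkCross (W 0 c) (W 0 e)) = 0 := by
    intro b c d e hn
    simp only [List.nodup_cons, List.mem_cons, List.not_mem_nil, or_false, not_or] at hn
    obtain ⟨⟨h0b, h0c, h0d, h0e⟩, ⟨hbc, hbd, hbe⟩, ⟨hcd, hce⟩, hde, -⟩ := hn
    have := walkCross_closed (((W 0 b).append (W b c)).append (W 0 c).reverse)
      (((W 0 d).append (W d e)).append (W 0 e).reverse)
    simp only [walkCross_append_left, walkCross_append_right, walkCross_reverse_left,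
      walkCross_reverse_right] at this
    rw [hzero b c d e, hzero b c 0 d, hzero b c 0 e, hzero 0 b d e, hzero 0 c d e] at this
    · linear_combination this
    all_goals first | assumption | exact Ne.symm ‹_›
  have hstar := star_crossing (p := W 0 2) (q := W 0 3) (m := W 0 4)
    (hnot _ _ _ (by decide) (by decide) (by decide))
    (hnot _ _ _ (by decide) (by decide) (by decide))
    (hnot _ _ _ (by decide) (by decide) (by decide))
    (hnot _ _ _ (by decide) (by decide) (by decide))
    (hnot _ _ _ (by decide) (by decide) (by decide))
    (hnot _ _ _ (by decide) (by decide) (by decide))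
  have h1 := htri 1 2 3 4 (by decide)
  have h2 := htri 1 3 2 4 (by decide)
  have h3 := htri 1 4 2 3 (by decide)
  grind

theorem not_isMinorModel_K33_halfGrid (B : Fin 3 ⊕ Fin 3 → Set (ℤ × ℕ)) :
    ¬ IsMinorModel K33 HalfGrid B := by
  intro h
  choose f hf using h.nonempty
  have hw : ∀ i j : Fin 3, ∃ p : HalfGrid.Walk (f (.inl i)) (f (.inr j)),
      ∀ x ∈ p.support, x ∈ B (.inl i) ∨ x ∈ B (.inr j) :=
    fun i j => exists_walk_of_adj h hf (by simp)
  choose W hW using hw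
  have hzero : ∀ i j i' j', i ≠ i' → j ≠ j' → walkCross (W i j) (W i' j') = 0 := by
    intro i j i' j' hi hj
    refine walkCross_eq_zero_of_disjoint fun x hx hx' => ?_
    rcases hW i j x hx with hx | hx <;> rcases hW i' j' x hx' with hx' | hx' <;>
      have := eq_of_mem_of_mem h hx hx' <;> simp_all
  have hnot : ∀ i j k, k ≠ j → f (.inr k) ∉ (W i j).support := by
    intro i j k hkj hx
    rcases hW i j _ hx with hx | hx <;> have := eq_of_mem_of_mem h (hf _) hx <;> simp_all
  have hcyc : ∀ i j i' j' k l k' l',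
      walkCross ((((W i j).append (W i' j).reverse).append (W i' j')).append (W i j').reverse)
        ((((W k l).append (W k' l).reverse).append (W k' l')).append (W k l').reverse) = 0 :=
    fun i j i' j' k l k' l' => walkCross_closed _ _
  simp only [walkCross_append_left, walkCross_append_right, walkCross_reverse_left,
      walkCross_reverse_right] at hcyc
  have h1 := hcyc 0 0 1 1 0 0 2 2
  have h2 := hcyc 0 0 1 2 0 0 2 1
  have hstar := star_crossing (p := W 0 0) (q := W 0 1) (m := W 0 2)
    (hnot _ _ _ (by decide)) (hnot _ _ _ (by decide)) (hnot _ _ _ (by decide))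
    (hnot _ _ _ (by decide)) (hnot _ _ _ (by decide)) (hnot _ _ _ (by decide))
  simp only [hzero 0 0 2 2 (by decide) (by decide), hzero 0 0 2 1 (by decide) (by decide),
    hzero 0 1 2 0 (by decide) (by decide), hzero 0 1 2 2 (by decide) (by decide),
    hzero 0 2 2 0 (by decide) (by decide), hzero 0 2 2 1 (by decide) (by decide),
    hzero 1 0 0 1 (by decide) (by decide), hzero 1 0 0 2 (by decide) (by decide),
    hzero 1 1 0 0 (by decide) (by decide), hzero 1 1 0 2 (by decide) (by decide),
    hzero 1 2 0 0 (by decide) (by decide), hzero 1 2 0 1 (by decide) (by decide),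
    hzero 1 0 2 1 (by decide) (by decide), hzero 1 0 2 2 (by decide) (by decide),
    hzero 1 1 2 0 (by decide) (by decide), hzero 1 1 2 2 (by decide) (by decide),
    hzero 1 2 2 0 (by decide) (by decide), hzero 1 2 2 1 (by decide) (by decide)] at h1 h2
  grind

/-! ### Walks from the left to the right part of the boundary confine rays -/

lemma walkSum_column (x : ℤ) {s t : ℤ × ℕ} (p : HalfGrid.Walk s t) :
    walkSum (fun a b => if a.2 = b.2 ∧ max a.1 b.1 = x then 1 else 0) p =
      (if s.1 < x then 1 else 0) + (if t.1 < x then 1 else 0) := by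
  rw [← walkSum_coboundary (fun a => if a.1 < x then 1 else 0) p]
  refine walkSum_congr _ fun a _ b _ hab => ?_
  rw [halfGrid_adj] at hab
  simp only [GridRel] at hab
  split_ifs <;> first | omega | decide

/-- A walk from `(a, 0)` to `(b, 0)` avoiding the part of the column of `r` below `r`, where
`a < r.1 ≤ b`, meets every walk from `r` to a vertex outside a box containing it. -/
lemma exists_mem_support_of_enclosed {a b : ℤ} (p : HalfGrid.Walk (a, 0) (b, 0)) {r r' : ℤ × ℕ}
    (q : HalfGrid.Walk r r') (ha : a < r.1) (hb : r.1 ≤ b)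
    (hcol : ∀ y ≤ r.2, (r.1, y) ∉ p.support) {M : ℕ}
    (hM : ∀ z ∈ p.support, z.1.natAbs ≤ M ∧ z.2 ≤ M) (hr' : M < r'.1.natAbs ∨ M < r'.2) :
    ∃ z ∈ q.support, z ∈ p.support := by
  by_contra! hdisj
  have hconst : walkSum (rayCross r) p + walkSum (rayCross r') p = 0 := by
    rw [← walkSum_coboundary (fun v => walkSum (rayCross v) p) q]
    refine walkSum_eq_zero _ fun c hc d hd hcd => ?_
    have habove : ∀ x : ℤ, (x, 0) ∈ p.support → above c d (x, 0) = 0 := by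
      intro x hx
      have h1 : (x, 0) ≠ c := fun h => hdisj c hc (h ▸ hx)
      have h2 : (x, 0) ≠ d := fun h => hdisj d hd (h ▸ hx)
      rw [ne_eq, Prod.ext_iff] at h1 h2
      rw [above, if_neg]
      dsimp only at h1 h2 ⊢
      omega
    rw [walkSum_rayCross_add p hcd, habove a p.start_mem_support, habove b p.end_mem_support,
      walkSum_eq_zero, add_zero, add_zero]
    exact fun u hu v hv _ => edgeCross_eq_zero (fun h => hdisj c hc (h ▸ hu))
      (fun h => hdisj c hc (h ▸ hv)) (fun h => hdisj d hd (h ▸ hu)) (fun h => hdisj d hd (h ▸ hv))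
  have hfar : walkSum (rayCross r') p = 0 := by
    refine walkSum_eq_zero _ fun u hu v hv huv => ?_
    have := hM u hu
    have := hM v hv
    rw [rayCross, if_neg]
    omega
  have hnear : walkSum (rayCross r) p = 1 := by
    have h := walkSum_column r.1 p
    rw [if_pos ha, if_neg (by simpa using hb), add_zero] at h
    rw [← h]
    refine walkSum_congr _ fun u hu v hv huv => if_congr ⟨fun h => ⟨h.1, h.2.2⟩, fun h => ?_⟩ rfl rfl
    refine ⟨h.1, ?_, h.2⟩
    by_contra! hlt
    rcases max_choice u.1 v.1 with hm | hm
    · exact hcol u.2 hlt.le (by rw [← h.2, hm]; exact hu)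
    · exact hcol v.2 (h.1 ▸ hlt.le) (by rw [← h.2, hm]; exact hv)
  rw [hfar, hnear] at hconst
  exact absurd hconst (by decide)

/-! ### Projecting the graph `G` to the half-grid -/

/-- The projection of `G` to the half-grid collapsing every attached graph. -/
def proj : GV → ℤ × ℕ
  | .inl p => p
  | .inr (.inl w) => (w.1.1, 0)
  | .inr (.inr w) => (w.1.1, 0)

lemma graphG_adj_cases {x y : GV} (h : GraphG.Adj x y) :
    proj x = proj y ∨ ∃ p q, x = .inl p ∧ y = .inl q ∧ HalfGrid.Adj p q := by
  rw [GraphG, fromRel_adj] at h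
  obtain ⟨-, h⟩ := h
  rcases x with p | w | w <;> rcases y with q | w' | w' <;> simp only [GRel, proj] at h ⊢
  · exact .inr ⟨p, q, rfl, rfl, halfGrid_adj.2 h⟩
  all_goals grind

/-- The vertices of the half-grid in `S`. -/
def base (S : Set GV) : Set (ℤ × ℕ) := {z | (.inl z : GV) ∈ S}

lemma inl_proj_mem_support {x y : GV} (p : GraphG.Walk x y) (h : proj x ≠ proj y) :
    .inl (proj x) ∈ p.support := by
  induction p with
  | nil => exact (h rfl).elim
  | cons hadj p ih =>
    rcases graphG_adj_cases hadj with he | ⟨a, b, rfl, -, -⟩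
    · rw [he] at h ⊢
      exact List.mem_cons_of_mem _ (ih h)
    · simp [proj]

lemma exists_walk_proj {x y : GV} (p : GraphG.Walk x y) :
    ∃ q : HalfGrid.Walk (proj x) (proj y), ∀ z ∈ q.support, ∃ w ∈ p.support, proj w = z := by
  induction p with
  | nil => exact ⟨.nil, by simp⟩
  | @cons u v w hadj p ih =>
    obtain ⟨q, hq⟩ := ih
    rcases graphG_adj_cases hadj with he | ⟨a, b, rfl, rfl, hab⟩
    · refine ⟨q.copy he.symm rfl, fun z hz => ?_⟩
      obtain ⟨w, hw, rfl⟩ := hq z (by simpa using hz)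
      exact ⟨w, by simp [hw], rfl⟩
    · refine ⟨.cons hab q, fun z hz => ?_⟩
      rcases List.mem_cons.1 hz with rfl | hz
      · exact ⟨.inl z, by simp, rfl⟩
      · obtain ⟨w, hw, rfl⟩ := hq z hz
        exact ⟨w, by simp [hw], rfl⟩

section Linked

variable {S T : Set GV}

lemma proj_mem_base_of_ne (hS : Linked GraphG S) {x y : GV} (hx : x ∈ S) (hy : y ∈ S)
    (h : proj x ≠ proj y) : proj x ∈ base S := by
  obtain ⟨p, hp⟩ := hS hx hy
  exact hp _ (inl_proj_mem_support p h)

lemma proj_mem_base (hS : Linked GraphG S) (hne : (base S).Nonempty) {x : GV} (hx : x ∈ S) :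
    proj x ∈ base S := by
  obtain ⟨z, hz⟩ := hne
  by_cases h : proj x = z
  · rwa [h]
  · exact proj_mem_base_of_ne hS hx hz h

lemma linked_base (hS : Linked GraphG S) : Linked HalfGrid (base S) := by
  intro u hu v hv
  obtain ⟨p, hp⟩ := hS hu hv
  obtain ⟨q, hq⟩ := exists_walk_proj p
  refine ⟨q, fun z hz => ?_⟩
  obtain ⟨w, hw, rfl⟩ := hq z hz
  exact proj_mem_base hS ⟨u, hu⟩ (hp w hw)

/-- Disjoint linked sets meeting the same fibre are adjacent only inside this fibre. -/
lemma proj_eq_of_adj (hS : Linked GraphG S) (hT : Linked GraphG T) (hST : Disjoint S T)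
    {s t x y : GV} (hs : s ∈ S) (ht : t ∈ T) (hst : proj s = proj t) (hx : x ∈ S) (hy : y ∈ T)
    (hxy : GraphG.Adj x y) : proj x = proj s ∧ proj y = proj s := by
  have key : proj s ∈ base S → proj s ∈ base T → False := fun h h' => Set.disjoint_left.1 hST h h'
  by_cases h1 : proj x = proj s
  · refine ⟨h1, by_contra fun h2 => ?_⟩
    rcases graphG_adj_cases hxy with he | ⟨a, b, rfl, rfl, -⟩
    · exact h2 (he ▸ h1)
    · exact key (h1 ▸ hx) (hst ▸ proj_mem_base_of_ne hT ht hy fun h => h2 (by rw [hst, h]))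
  · exfalso
    have h3 := proj_mem_base_of_ne hS hs hx (Ne.symm h1)
    by_cases h2 : proj y = proj s
    · rcases graphG_adj_cases hxy with he | ⟨a, b, rfl, rfl, -⟩
      · exact h1 (he.trans h2)
      · exact key h3 (h2 ▸ hy)
    · exact key h3 (hst ▸ proj_mem_base_of_ne hT ht hy fun h => h2 (by rw [hst, h]))

end Linked

/-! ### Minors of `G` that are not minors of the half-grid -/

section Minors

variable {α : Type*} {X : SimpleGraph α}

lemma isMinorModel_base {B : α → Set GV} (h : IsMinorModel X GraphG B)
    (hne : ∀ v, (base (B v)).Nonempty) : IsMinorModel X HalfGrid fun v => base (B v) where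
  nonempty := hne
  connected v := connected_of_linked (linked_base (linked_of_connected (h.connected v))) (hne v)
  pairwise_disjoint v w hvw :=
    Set.disjoint_left.2 fun _ hz hz' => Set.disjoint_left.1 (h.pairwise_disjoint hvw) hz hz'
  adj v w hvw := by
    obtain ⟨x, hx, y, hy, hxy⟩ := h.adj hvw
    rcases graphG_adj_cases hxy with he | ⟨p, q, rfl, rfl, hpq⟩
    · have h1 := proj_mem_base (linked_of_connected (h.connected v)) (hne v) hx
      have h2 := proj_mem_base (linked_of_connected (h.connected w)) (hne w) hy
      rw [he] at h1
      exact (hvw.ne (eq_of_mem_of_mem h h1 h2)).elim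
    · exact ⟨p, hx, q, hy, hpq⟩

/-- A branch set without vertices in the half-grid has all its neighbours in its own fibre. -/
lemma exists_proj_eq {B : α → Set GV} (h : IsMinorModel X GraphG B) {u v : α} {x : GV}
    (hvu : X.Adj v u) (hv : base (B v) = ∅) (hx : x ∈ B v) : ∃ y ∈ B u, proj y = proj x := by
  obtain ⟨x', hx', y, hy, hxy⟩ := h.adj hvu
  have hxx' : proj x = proj x' := by
    by_contra hne
    exact Set.eq_empty_iff_forall_notMem.1 hv _
      (proj_mem_base_of_ne (linked_of_connected (h.connected v)) hx hx' hne)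
  rcases graphG_adj_cases hxy with he | ⟨p, q, rfl, rfl, -⟩
  · exact ⟨y, hy, (hxx'.trans he).symm⟩
  · exact (Set.eq_empty_iff_forall_notMem.1 hv p hx').elim

lemma exists_right_of_adj {b : NonnegInt} {x y : GV} (hx : proj x = (b.1, 0))
    (hy : proj y = (b.1, 0)) (hxy : GraphG.Adj x y) :
    ∃ j : {j : Fin 5 // 2 ≤ (j : ℕ)}, x = .inr (.inr (b, j.1)) ∨ y = .inr (.inr (b, j.1)) := by
  rw [GraphG, fromRel_adj] at hxy
  obtain ⟨hne, hxy⟩ := hxy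
  obtain ⟨b, hb⟩ := b
  rcases x with p | ⟨⟨a, ha⟩, i⟩ | ⟨⟨a, ha⟩, i⟩ <;>
    rcases y with q | ⟨⟨a', ha'⟩, i'⟩ | ⟨⟨a', ha'⟩, i'⟩ <;>
    simp only [GRel, proj, Prod.mk.injEq, and_true] at hx hy hxy
  all_goals subst hx hy
  all_goals try omega
  · exact (hne rfl).elim
  · exact ⟨⟨i', by simpa using hxy⟩, .inr rfl⟩
  · exact ⟨⟨i, by simpa using hxy⟩, .inl rfl⟩
  · rcases hxy with hxy | hxy
    · exact ⟨⟨i', hxy.2.2⟩, .inr rfl⟩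
    · exact ⟨⟨i, hxy.2.2⟩, .inl rfl⟩

lemma exists_mem_of_isMinorModel_K5 {B : Fin 5 → Set GV} (h : IsMinorModel K5 GraphG B) :
    ∃ v a i, .inr (.inl (a, i)) ∈ B v := by
  by_contra! hno
  obtain ⟨v, hv⟩ : ∃ v, base (B v) = ∅ := by
    by_contra! hne
    exact not_isMinorModel_K5_halfGrid _ (isMinorModel_base h hne)
  obtain ⟨x, hx⟩ := h.nonempty v
  rcases x with p | ⟨a, i⟩ | ⟨b, i⟩
  · exact Set.eq_empty_iff_forall_notMem.1 hv p hx
  · exact hno v a i hx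
  have hmeet : ∀ u, ∃ y ∈ B u, proj y = (b.1, 0) := fun u => by
    by_cases huv : v = u
    · exact ⟨_, huv ▸ hx, rfl⟩
    · exact exists_proj_eq h huv hv hx
  have hright : ∀ u w, u ≠ w → ∃ j : {j : Fin 5 // 2 ≤ (j : ℕ)},
      .inr (.inr (b, j.1)) ∈ B u ∨ .inr (.inr (b, j.1)) ∈ B w := fun u w huw => by
    obtain ⟨s, hs, hsb⟩ := hmeet u
    obtain ⟨t, ht, htb⟩ := hmeet w
    obtain ⟨x, hx, y, hy, hxy⟩ := h.adj (v := u) (w := w) huw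
    obtain ⟨hxs, hys⟩ := proj_eq_of_adj (linked_of_connected (h.connected u))
      (linked_of_connected (h.connected w)) (h.pairwise_disjoint huw) hs ht (hsb.trans htb.symm)
      hx hy hxy
    obtain ⟨j, rfl | rfl⟩ := exists_right_of_adj (hxs.trans hsb) (hys.trans hsb) hxy
    · exact ⟨j, .inl hx⟩
    · exact ⟨j, .inr hy⟩
  have hcode : ∀ u, ∃ o : Option {j : Fin 5 // 2 ≤ (j : ℕ)},
      (∀ j, o = some j → .inr (.inr (b, j.1)) ∈ B u) ∧
        (o = none → ∀ j : {j : Fin 5 // 2 ≤ (j : ℕ)}, .inr (.inr (b, j.1)) ∉ B u) := fun u => by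
    by_cases hu : ∃ j : {j : Fin 5 // 2 ≤ (j : ℕ)}, .inr (.inr (b, j.1)) ∈ B u
    · obtain ⟨j, hj⟩ := hu
      exact ⟨some j, by simpa using hj, by simp⟩
    · exact ⟨none, by simp, fun _ j hj => hu ⟨j, hj⟩⟩
  choose f hf using hcode
  have hinj : Function.Injective f := fun u w huw => by
    by_contra hne
    cases hfu : f u with
    | none =>
      obtain ⟨j, hj | hj⟩ := hright u w hne
      · exact (hf u).2 hfu j hj
      · exact (hf w).2 (huw ▸ hfu) j hj
    | some j => exact hne (eq_of_mem_of_mem h ((hf u).1 j hfu) ((hf w).1 j (huw ▸ hfu)))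
  have := Fintype.card_le_of_injective f hinj
  revert this
  decide

lemma eq_of_proj_eq {a : NegInt} {x : GV} (hx : proj x = (a.1, 0)) :
    x = .inl (a.1, 0) ∨ ∃ i, x = .inr (.inl (a, i)) := by
  obtain ⟨a, ha⟩ := a
  rcases x with p | ⟨⟨c, hc⟩, i⟩ | ⟨⟨c, hc⟩, i⟩ <;>
    simp only [proj, Prod.mk.injEq, and_true] at hx
  · exact .inl (by rw [hx])
  · subst hx
    exact .inr ⟨i, rfl⟩
  · omega

lemma exists_mem_of_isMinorModel_K33 {B : Fin 3 ⊕ Fin 3 → Set GV}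
    (h : IsMinorModel K33 GraphG B) : ∃ v b i, .inr (.inr (b, i)) ∈ B v := by
  by_contra! hno
  obtain ⟨v, hv⟩ : ∃ v, base (B v) = ∅ := by
    by_contra! hne
    exact not_isMinorModel_K33_halfGrid _ (isMinorModel_base h hne)
  obtain ⟨x, hx⟩ := h.nonempty v
  rcases x with p | ⟨a, i⟩ | ⟨b, i⟩
  · exact Set.eq_empty_iff_forall_notMem.1 hv p hx
  swap
  · exact hno v b i hx
  obtain ⟨w, hvw, hw⟩ : ∃ w, K33.Adj v w ∧ .inl (a.1, 0) ∉ B w := by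
    have h2 : ∃ w w', K33.Adj v w ∧ K33.Adj v w' ∧ w ≠ w' := by
      rcases v with v | v
      · exact ⟨.inr 0, .inr 1, by simp⟩
      · exact ⟨.inl 0, .inl 1, by simp⟩
    obtain ⟨w, w', hw, hw', hne⟩ := h2
    by_cases hmem : .inl (a.1, 0) ∈ B w
    · exact ⟨w', hw', fun hmem' => hne (eq_of_mem_of_mem h hmem hmem')⟩
    · exact ⟨w, hw, hmem⟩
  obtain ⟨y, hy, hya⟩ := exists_proj_eq h hvw hv hx
  have hwb : base (B w) = ∅ := by
    rw [← Set.not_nonempty_iff_eq_empty]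
    intro hne
    have := proj_mem_base (linked_of_connected (h.connected w)) hne hy
    rw [hya] at this
    exact hw this
  have hmeet : ∀ u, ∃ o : Option (Fin 4),
      o.elim (.inl (a.1, 0)) (fun i => .inr (.inl (a, i))) ∈ B u := fun u => by
    have hvwu : K33.Adj v u ∨ K33.Adj w u := by
      rcases v with v | v <;> rcases w with w | w <;> rcases u with u | u <;> simp_all
    have : ∃ z ∈ B u, proj z = (a.1, 0) := by
      rcases hvwu with hu | hu
      · exact exists_proj_eq h hu hv hx
      · obtain ⟨z, hz, hzy⟩ := exists_proj_eq h hu hwb hy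
        exact ⟨z, hz, hzy.trans hya⟩
    obtain ⟨z, hz, hza⟩ := this
    rcases eq_of_proj_eq hza with rfl | ⟨i, rfl⟩
    · exact ⟨none, hz⟩
    · exact ⟨some i, hz⟩
  choose f hf using hmeet
  have hinj : Function.Injective f := fun u w huw => eq_of_mem_of_mem h (huw ▸ hf u) (hf w)
  have := Fintype.card_le_of_injective f hinj
  simp at this

end Minors

/-! ### The graph `G` has no infinite family of disjoint models of `H` -/

lemma ray_adj {m n : ℕ} : Ray.Adj m n ↔ n = m + 1 ∨ m = n + 1 := by
  rw [Ray, fromRel_adj]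
  omega

lemma graphI_adj {u v : IV} : GraphI.Adj u v ↔ u ≠ v ∧ (IRel u v ∨ IRel v u) := by
  rw [GraphI, fromRel_adj]

lemma ray_preconnected : Ray.Preconnected := by
  have h : ∀ n, Ray.Reachable 0 n := fun n => by
    induction n with
    | zero => exact .refl _
    | succ n ih => exact ih.trans (Adj.reachable (ray_adj.2 (.inl rfl)))
  exact fun m n => (h m).symm.trans (h n)

lemma graphI_preconnected : GraphI.Preconnected := by
  have hr : ∀ j, GraphI.Reachable (.inl 0) (.inr (.inr j)) := fun j =>
    Adj.reachable (graphI_adj.2 (by simp [IRel]))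
  have h : ∀ v, GraphI.Reachable (.inl 0) v := by
    rintro (i | i | j)
    · by_cases hi : i = 0
      · rw [hi]
      · exact Adj.reachable (graphI_adj.2 (by simp [IRel, Ne.symm hi]))
    · exact (hr 0).trans (Adj.reachable (graphI_adj.2 (by simp [IRel])))
    · exact hr j
  exact fun u v => (h u).symm.trans (h v)

/-- The inclusion of `K₃,₃` in `I`. -/
def inclK33 : Fin 3 ⊕ Fin 3 → IV
  | .inl i => if h : i = 0 then .inl 0 else .inr (.inl (i.pred h))
  | .inr j => .inr (.inr j)

lemma inclK33_injective : Function.Injective inclK33 := by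
  decide

lemma inclK33_adj {u v : Fin 3 ⊕ Fin 3} (h : K33.Adj u v) :
    GraphI.Adj (inclK33 u) (inclK33 v) := by
  refine graphI_adj.2 ⟨fun he => h.ne (inclK33_injective he), ?_⟩
  rcases u with u | u <;> rcases v with v | v
  · simp at h
  · left
    simp only [inclK33]
    split_ifs <;> simp [IRel]
  · right
    simp only [inclK33]
    split_ifs <;> simp [IRel]
  · simp at h

/-- Every model of `I` in `G` contains a walk of the half-grid from the left to the right part
of its boundary. -/
lemma exists_walk_of_isMinorModel_graphI {B : IV → Set GV} (h : IsMinorModel GraphI GraphG B) :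
    ∃ a < 0, ∃ b ≥ 0, ∃ p : HalfGrid.Walk (a, 0) (b, 0), ∀ z ∈ p.support, .inl z ∈ ⋃ v, B v := by
  have hS : Linked GraphG (⋃ v, B v) := linked_iUnion h graphI_preconnected
  obtain ⟨v, a, i, hv⟩ := exists_mem_of_isMinorModel_K5
    (isMinorModel_comp h Sum.inl Sum.inl_injective fun u v huv =>
      graphI_adj.2 ⟨by simpa using huv, by simp [IRel]⟩)
  obtain ⟨w, b, j, hw⟩ := exists_mem_of_isMinorModel_K33
    (isMinorModel_comp h inclK33 inclK33_injective fun u v huv => inclK33_adj huv)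
  have hx : .inr (.inl (a, i)) ∈ ⋃ v, B v := Set.mem_iUnion_of_mem (.inl v) hv
  have hy : .inr (.inr (b, j)) ∈ ⋃ v, B v := Set.mem_iUnion_of_mem (inclK33 w) hw
  have hne : (base (⋃ v, B v)).Nonempty :=
    ⟨_, proj_mem_base_of_ne hS hx hy fun he => (a.2.trans_le b.2).ne (Prod.ext_iff.1 he).1⟩
  exact ⟨a.1, a.2, b.1, b.2, linked_base hS (proj_mem_base hS hne hx) (proj_mem_base hS hne hy)⟩

lemma finite_proj_preimage {s : Set (ℤ × ℕ)} (hs : s.Finite) : (proj ⁻¹' s).Finite := by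
  let tag : GV → Option (Fin 4 ⊕ Fin 5) := Sum.elim (fun _ => none)
    (Sum.elim (fun w => some (.inl w.2)) fun w => some (.inr w.2))
  refine hs.preimage' fun z _ => Set.Finite.of_finite_image (Set.toFinite (tag '' _)) ?_
  intro x hx y hy hxy
  have he : proj x = proj y := hx.trans hy.symm
  rcases x with p | ⟨⟨a, ha⟩, i⟩ | ⟨⟨a, ha⟩, i⟩ <;>
    rcases y with q | ⟨⟨c, hc⟩, j⟩ | ⟨⟨c, hc⟩, j⟩ <;> simp_all [tag, proj]
  all_goals exact (Prod.ext_iff.1 (hx.trans hy.symm)).1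

lemma infinite_base_of_isMinorModel_ray {B : ℕ → Set GV} (h : IsMinorModel Ray GraphG B) :
    (base (⋃ n, B n)).Infinite := by
  have hS : Linked GraphG (⋃ n, B n) := linked_iUnion h ray_preconnected
  choose f hf using h.nonempty
  have hmem : ∀ n, f n ∈ ⋃ n, B n := fun n => Set.mem_iUnion_of_mem n (hf n)
  have hinf : (⋃ n, B n).Infinite := Set.infinite_of_injective_forall_mem
    (f := f) (fun m n hmn => eq_of_mem_of_mem h (hf m) (hmn ▸ hf n)) hmem
  intro hfin
  rcases (base (⋃ n, B n)).eq_empty_or_nonempty with hemp | hne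
  · refine hinf ((finite_proj_preimage (Set.finite_singleton (proj (f 0)))).subset fun x hx => ?_)
    by_contra hx0
    exact Set.eq_empty_iff_forall_notMem.1 hemp _ (proj_mem_base_of_ne hS hx (hmem 0) hx0)
  · exact hinf ((finite_proj_preimage hfin).subset fun x hx => proj_mem_base hS hne hx)

lemma finite_box (N : ℕ) : {z : ℤ × ℕ | z.1.natAbs ≤ N ∧ z.2 ≤ N}.Finite := by
  refine ((Set.finite_Icc (-(N : ℤ)) N).prod (Set.finite_Iic N)).subset fun z hz => ?_
  simp only [Set.mem_ofPred_eq] at hz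
  simp only [Set.mem_prod, Set.mem_Icc, Set.mem_Iic]
  omega

lemma exists_box (l : List (ℤ × ℕ)) : ∃ M, ∀ z ∈ l, z.1.natAbs ≤ M ∧ z.2 ≤ M := by
  induction l with
  | nil => exact ⟨0, by simp⟩
  | cons w l ih =>
    obtain ⟨M, hM⟩ := ih
    refine ⟨M + w.1.natAbs + w.2, fun z hz => ?_⟩
    rcases List.mem_cons.1 hz with rfl | hz
    · omega
    · have := hM z hz
      omega

lemma not_disjointModels (B : ℕ → IV ⊕ ℕ → Set GV) : ¬ DisjointModels GraphH GraphG B := by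
  rintro ⟨hB, hdisj⟩
  have hray : IsMinorModel Ray GraphG (B 0 ∘ Sum.inr) :=
    isMinorModel_comp (hB 0) Sum.inr Sum.inr_injective fun u v huv => sum_adj_inr.2 huv
  have hI : ∀ k, IsMinorModel GraphI GraphG (B k ∘ Sum.inl) := fun k =>
    isMinorModel_comp (hB k) Sum.inl Sum.inl_injective fun u v huv => sum_adj_inl.2 huv
  have hsub : ∀ {k l x}, k ≠ l → x ∈ ⋃ v, B k v → x ∉ ⋃ v, B l v := fun hkl hx hx' =>
    Set.disjoint_left.1 (hdisj hkl) hx hx'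
  have hIsub : ∀ k, ⋃ v, (B k ∘ Sum.inl) v ⊆ ⋃ v, B k v := fun k =>
    Set.iUnion_subset fun v => Set.subset_iUnion (B k) (.inl v)
  have hRsub : ⋃ v, (B 0 ∘ Sum.inr) v ⊆ ⋃ v, B 0 v :=
    Set.iUnion_subset fun v => Set.subset_iUnion (B 0) (.inr v)
  have hinf := infinite_base_of_isMinorModel_ray hray
  obtain ⟨r, hr⟩ := hinf.nonempty
  set N := r.1.natAbs + r.2 with hN
  obtain ⟨k, hk⟩ : ∃ k, ∀ z : ℤ × ℕ, z.1.natAbs ≤ N ∧ z.2 ≤ N →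
      .inl z ∉ ⋃ v, B (k + 1) v := by
    by_contra! hno
    choose f hf hfB using hno
    refine Set.infinite_of_injective_forall_mem (f := f) (fun k l hkl => ?_) hf (finite_box N)
    by_contra hne
    exact hsub (fun h => hne (Nat.succ_injective h)) (hfB k) (hkl ▸ hfB l)
  obtain ⟨a, ha, b, hb, p, hp⟩ := exists_walk_of_isMinorModel_graphI (hI (k + 1))
  have hpN : ∀ z ∈ p.support, ¬ (z.1.natAbs ≤ N ∧ z.2 ≤ N) := fun z hz hzN =>
    hk z hzN (hIsub _ (hp z hz))
  have haN := hpN _ p.start_mem_support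
  have hbN := hpN _ p.end_mem_support
  dsimp only at haN hbN
  obtain ⟨M, hM⟩ := exists_box p.support
  obtain ⟨r', hr', hr'M⟩ := hinf.exists_notMem_finite (finite_box M)
  obtain ⟨q, hq⟩ := linked_base (linked_iUnion hray ray_preconnected) hr hr'
  obtain ⟨z, hzq, hzp⟩ := exists_mem_support_of_enclosed p q (by omega) (by omega)
    (fun y hy hmem => hpN _ hmem (by dsimp only; omega)) hM
    (by simp only [Set.mem_ofPred_eq] at hr'M; omega)
  exact hsub k.succ_ne_zero (hIsub _ (hp z hzp)) (hRsub (hq z hzq))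

/-! ### Finite families of disjoint models of `H` in `G` -/

lemma graphG_adj {x y : GV} : GraphG.Adj x y ↔ x ≠ y ∧ (GRel x y ∨ GRel y x) := by
  rw [GraphG, fromRel_adj]

lemma connected_induce_of_descent {V : Type*} {G : SimpleGraph V} {S : Set V} {c : V} (hc : c ∈ S)
    (d : V → ℕ) (h : ∀ v ∈ S, v ≠ c → ∃ w ∈ S, G.Adj v w ∧ d w < d v) :
    (G.induce S).Connected := by
  have hreach : ∀ n, ∀ v : S, d v = n → (G.induce S).Reachable v ⟨c, hc⟩ := fun n => by
    induction n using Nat.strong_induction_on with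
    | _ n ih =>
      rintro ⟨v, hv⟩ rfl
      by_cases hvc : v = c
      · subst hvc
        exact .refl _
      · obtain ⟨w, hw, hvw, hlt⟩ := h v hv hvc
        have hadj : (G.induce S).Adj ⟨v, hv⟩ ⟨w, hw⟩ := hvw
        exact hadj.reachable.trans (ih (d w) hlt ⟨w, hw⟩ rfl)
  have : Nonempty S := ⟨⟨c, hc⟩⟩
  exact ⟨fun u v => (hreach _ u rfl).trans (hreach _ v rfl).symm⟩

/-- `Owns n k v x` says that `x` belongs to the branch set of the vertex `v` of `H` in the `k`-th
of `n` disjoint models: the identified vertex of `I` is inflated to an arch joining `(-k-1, 0)` to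
`(k, 0)`, and the ray is the column of `n + k`. -/
def Owns (n k : ℕ) : IV ⊕ ℕ → GV → Prop
  | .inl (.inl i), .inl z => i = 0 ∧
      ((z.2 = k ∧ -(k : ℤ) - 1 ≤ z.1 ∧ z.1 ≤ k) ∨ (z.2 ≤ k ∧ (z.1 = k ∨ z.1 = -(k : ℤ) - 1)))
  | .inl (.inl i), .inr (.inl w) => w.1.1 = -(k : ℤ) - 1 ∧ (i : ℕ) = w.2 + 1
  | .inl (.inr (.inl i)), .inr (.inr w) => w.1.1 = k ∧ (w.2 : ℕ) = i
  | .inl (.inr (.inr j)), .inr (.inr w) => w.1.1 = k ∧ (w.2 : ℕ) = j + 2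
  | .inr m, .inl z => z.1 = n + k ∧ z.2 = m
  | _, _ => False

lemma owns_unique {n k l : ℕ} (hk : k < n) (hl : l < n) {v w : IV ⊕ ℕ} {x : GV}
    (hv : Owns n k v x) (hw : Owns n l w x) : k = l ∧ v = w := by
  rcases v with (i | i | i) | i <;> rcases w with (j | j | j) | j <;>
    rcases x with z | ⟨c, e⟩ | ⟨c, e⟩ <;> simp only [Owns] at hv hw <;>
    simp only [Sum.inl.injEq, Sum.inr.injEq, Fin.ext_iff, reduceCtorEq, and_false] <;> omega

/-- A vertex of the branch set of a given vertex of `H`. -/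
def root (n k : ℕ) : IV ⊕ ℕ → GV
  | .inl (.inl i) => if h : i = 0 then .inl (0, k) else
      .inr (.inl (⟨-(k : ℤ) - 1, by omega⟩, i.pred h))
  | .inl (.inr (.inl i)) => .inr (.inr (⟨k, by omega⟩, i.castLE (by omega)))
  | .inl (.inr (.inr j)) => .inr (.inr (⟨k, by omega⟩, j.natAdd 2))
  | .inr m => .inl (n + k, m)

lemma owns_root (n k : ℕ) (v : IV ⊕ ℕ) : Owns n k v (root n k v) := by
  rcases v with (i | i | i) | i
  · by_cases h : i = 0
    · rw [root, dif_pos h]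
      exact ⟨h, by dsimp only; omega⟩
    · have : (i : ℕ) ≠ 0 := fun h' => h (Fin.ext h')
      rw [root, dif_neg h]
      exact ⟨rfl, by rw [Fin.val_pred]; omega⟩
  all_goals simp [root, Owns, add_comm]

lemma eq_root_of_owns {n k : ℕ} {v : IV ⊕ ℕ} (hv : v ≠ .inl (.inl 0)) {x : GV}
    (h : Owns n k v x) : x = root n k v := by
  have h0 := owns_root n k v
  generalize root n k v = y at h0
  rcases v with (i | i | i) | i
  · have : (i : ℕ) ≠ 0 := fun h' => hv (by rw [Fin.ext (b := 0) h'])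
    rcases x with z | ⟨⟨c, _⟩, e⟩ | ⟨c, e⟩ <;> rcases y with z' | ⟨⟨c', _⟩, e'⟩ | ⟨c', e'⟩ <;>
      simp only [Owns, Sum.inl.injEq, Sum.inr.injEq, Prod.mk.injEq, Subtype.mk.injEq,
        Fin.ext_iff] at * <;> omega
  all_goals
    rcases x with z | ⟨c, e⟩ | ⟨⟨c, _⟩, e⟩ <;> rcases y with z' | ⟨c', e'⟩ | ⟨⟨c', _⟩, e'⟩ <;>
      simp only [Owns, Sum.inl.injEq, Sum.inr.injEq, Prod.ext_iff, Subtype.mk.injEq,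
        Fin.ext_iff] at h h0 ⊢ <;> omega

lemma connected_owns (n k : ℕ) (v : IV ⊕ ℕ) : (GraphG.induce {x | Owns n k v x}).Connected := by
  by_cases hv : v = .inl (.inl 0)
  · subst hv
    refine connected_induce_of_descent (owns_root n k _)
      (Sum.elim (fun z => (k - z.2) + z.1.natAbs) fun _ => 0) fun x hx hne => ?_
    rcases x with ⟨x, y⟩ | ⟨c, e⟩ | ⟨c, e⟩ <;> simp only [Set.mem_ofPred_eq, Owns] at hx
    · obtain ⟨-, hx⟩ := hx
      have hne' : ¬ (x = 0 ∧ y = k) := fun h => hne (by simp [root, h.1, h.2])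
      have key : ∃ x' y', (GridRel (x, y) (x', y') ∨ GridRel (x', y') (x, y)) ∧
          Owns n k (.inl (.inl 0)) (.inl (x', y')) ∧
          (k - y') + x'.natAbs < (k - y) + x.natAbs := by
        simp only [GridRel]
        rcases lt_or_ge y k with hy | hy
        · exact ⟨x, y + 1, by omega, ⟨rfl, by dsimp only; omega⟩, by omega⟩
        rcases lt_or_ge 0 x with hx0 | hx0
        · exact ⟨x - 1, y, by omega, ⟨rfl, by dsimp only; omega⟩, by omega⟩
        · exact ⟨x + 1, y, by omega, ⟨rfl, by dsimp only; omega⟩, by omega⟩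
      obtain ⟨x', y', hadj, hown, hlt⟩ := key
      refine ⟨.inl (x', y'), hown, graphG_adj.2 ⟨fun he => ?_, hadj⟩, hlt⟩
      simp only [Sum.inl.injEq, Prod.mk.injEq] at he
      obtain ⟨rfl, rfl⟩ := he
      exact lt_irrefl _ hlt
    · simp at hx
  · exact connected_induce_of_descent (owns_root n k v) (fun _ => 0)
      fun x hx hne => (hne (eq_root_of_owns hv hx)).elim

lemma exists_adj_of_irel {n k : ℕ} {u v : IV} (hne : u ≠ v) (h : IRel u v) :
    ∃ x y, Owns n k (.inl u) x ∧ Owns n k (.inl v) y ∧ GraphG.Adj x y := by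
  rcases u with i | i | i <;> rcases v with j | j | j <;> simp only [IRel] at h
  · have hij : i ≠ j := fun h => hne (by rw [h])
    have hown : ∀ i : Fin 5, i ≠ 0 → ∃ e : Fin 4, (i : ℕ) = e + 1 := fun i hi => by
      obtain ⟨e, rfl⟩ := Fin.exists_succ_eq.2 hi
      exact ⟨e, rfl⟩
    have ha : -(k : ℤ) - 1 < 0 := by omega
    by_cases hi : i = 0
    · obtain ⟨e, he⟩ := hown j (hi ▸ hij.symm)
      exact ⟨.inl (-(k : ℤ) - 1, 0), .inr (.inl (⟨_, ha⟩, e)), by simp [Owns, hi],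
        by simp [Owns, he], graphG_adj.2 (by simp [GRel])⟩
    obtain ⟨e, he⟩ := hown i hi
    by_cases hj : j = 0
    · exact ⟨.inr (.inl (⟨_, ha⟩, e)), .inl (-(k : ℤ) - 1, 0), by simp [Owns, he],
        by simp [Owns, hj], graphG_adj.2 (by simp [GRel])⟩
    obtain ⟨e', he'⟩ := hown j hj
    have hee' : e ≠ e' := fun h => hij (Fin.ext (by rw [he, he', h]))
    exact ⟨.inr (.inl (⟨_, ha⟩, e)), .inr (.inl (⟨_, ha⟩, e')), by simp [Owns, he],
      by simp [Owns, he'], graphG_adj.2 (by simp [GRel, hee'])⟩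
  · exact ⟨.inl (k, 0), root n k (.inl (.inr (.inr j))), by simp [Owns, h], owns_root n k _,
      graphG_adj.2 (by simp [root, GRel])⟩
  · refine ⟨root n k (.inl (.inr (.inl i))), root n k (.inl (.inr (.inr j))), owns_root n k _,
      owns_root n k _, graphG_adj.2 ?_⟩
    have := i.2
    simp [root, GRel, Fin.ext_iff]
    omega

lemma isMinorModel_owns {n k : ℕ} (hk : k < n) :
    IsMinorModel GraphH GraphG fun v => {x | Owns n k v x} where
  nonempty v := ⟨_, owns_root n k v⟩
  connected := connected_owns n k
  pairwise_disjoint v w hvw :=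
    Set.disjoint_left.2 fun _ hv hw => hvw (owns_unique hk hk hv hw).2
  adj v w hvw := by
    rcases v with v | v <;> rcases w with w | w
    · obtain ⟨hne, h | h⟩ := graphI_adj.1 (sum_adj_inl.1 hvw)
      · obtain ⟨x, y, hx, hy, hxy⟩ := exists_adj_of_irel (n := n) (k := k) hne h
        exact ⟨x, hx, y, hy, hxy⟩
      · obtain ⟨x, y, hx, hy, hxy⟩ := exists_adj_of_irel (n := n) (k := k) hne.symm h
        exact ⟨y, hy, x, hx, hxy.symm⟩
    · simp [GraphH] at hvw
    · simp [GraphH] at hvw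
    · refine ⟨root n k (.inr v), owns_root n k (.inr v), root n k (.inr w),
        owns_root n k (.inr w), graphG_adj.2 ?_⟩
      have := ray_adj.1 (sum_adj_inr.1 hvw)
      simp only [root, GRel, GridRel, ne_eq, Sum.inl.injEq, Prod.mk.injEq, true_and]
      omega

lemma exists_disjointModels (n : ℕ) :
    ∃ B : Fin n → IV ⊕ ℕ → Set GV, DisjointModels GraphH GraphG B := by
  refine ⟨fun k v => {x | Owns n k v x}, fun k => isMinorModel_owns k.2, fun k l hkl => ?_⟩
  refine Set.disjoint_left.2 fun x hk hl => hkl ?_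
  obtain ⟨v, hv⟩ := Set.mem_iUnion.1 hk
  obtain ⟨w, hw⟩ := Set.mem_iUnion.1 hl
  exact Fin.ext (owns_unique k.2 l.2 hv hw).1

theorem not_ubiquitous_graphH : ¬ Ubiquitous GraphH := fun h => by
  obtain ⟨B, hB⟩ := h GraphG exists_disjointModels
  exact not_disjointModels B hB

theorem finite_neighborSet_graphH (v : IV ⊕ ℕ) : (GraphH.neighborSet v).Finite := by
  rcases v with v | m
  · refine (Set.finite_range (Sum.inl : IV → IV ⊕ ℕ)).subset ?_
    rintro (w | w) hw
    · exact ⟨w, rfl⟩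
    · simp [GraphH] at hw
  · refine ((Set.finite_Iic (m + 1)).image Sum.inr).subset ?_
    rintro (w | w) hw
    · simp [GraphH] at hw
    · have := ray_adj.1 (sum_adj_inr (G := GraphI).1 hw)
      exact ⟨w, by simp only [Set.mem_Iic]; omega, rfl⟩

end GridUbiquity

/-- The graph `H` (the disjoint union of the 1-sum of `K₅` and `K₃,₃` with
a ray) is locally finite but not ubiquitous; in particular there exists a locally finite
graph that is not ubiquitous. -/
theorem statement0 :
    ((∀ v : IV ⊕ ℕ, (GraphH.neighborSet v).Finite) ∧ ¬ Ubiquitous GraphH) ∧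
    ∃ (V : Type) (X : SimpleGraph V),
      (∀ v : V, (X.neighborSet v).Finite) ∧ ¬ Ubiquitous X := by
  exact ⟨⟨GridUbiquity.finite_neighborSet_graphH, GridUbiquity.not_ubiquitous_graphH⟩,
    IV ⊕ ℕ, GraphH, GridUbiquity.finite_neighborSet_graphH, GridUbiquity.not_ubiquitous_graphH⟩
end

section
/- The graph G does not contain infinitely many pairwise vertex-disjoint H-minors. -/
open SimpleGraph

/-! ### Mod 2 chains in the square grid `ℤ × ℤ` -/

/-- Edges of the square grid: `hor x y` joins `(x, y)` to `(x + 1, y)` and `ver x y` joins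
`(x, y)` to `(x, y + 1)`. -/
inductive GridEdge : Type
  | hor (x y : ℤ) : GridEdge
  | ver (x y : ℤ) : GridEdge

namespace GridEdge

def src : GridEdge → ℤ × ℤ
  | hor x y => (x, y)
  | ver x y => (x, y)

def tgt : GridEdge → ℤ × ℤ
  | hor x y => (x + 1, y)
  | ver x y => (x, y + 1)

/-- One of the two faces at an edge; a face is named by its lower left corner. -/
def faceA : GridEdge → ℤ × ℤ
  | hor x y => (x, y)
  | ver x y => (x, y)

/-- The other face at an edge. -/
def faceB : GridEdge → ℤ × ℤ
  | hor x y => (x, y - 1)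
  | ver x y => (x - 1, y)

/-- The edge `g` has the two ends `p` and `q`. -/
def Joins (g : GridEdge) (p q : ℤ × ℤ) : Prop :=
  (g.src = p ∧ g.tgt = q) ∨ (g.src = q ∧ g.tgt = p)

/-- The coboundary of a function on grid vertices. -/
def cobdry (κ : ℤ × ℤ → ZMod 2) (g : GridEdge) : ZMod 2 := κ g.src + κ g.tgt

/-- The edges whose two faces have different values under `w`. -/
def faceBdry (w : ℤ × ℤ → ZMod 2) (g : GridEdge) : ZMod 2 := w g.faceA + w g.faceB

lemma Joins.cobdry_eq {g : GridEdge} {p q : ℤ × ℤ} (h : g.Joins p q) (κ : ℤ × ℤ → ZMod 2) :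
    cobdry κ g = κ p + κ q := by
  rcases h with ⟨rfl, rfl⟩ | ⟨rfl, rfl⟩
  · rfl
  · exact add_comm _ _

end GridEdge

open GridEdge

/-- The value of an edge function on a mod 2 chain. -/
noncomputable abbrev chainEval (f : GridEdge → ZMod 2) :
    (GridEdge →₀ ZMod 2) →ₗ[ZMod 2] ZMod 2 :=
  Finsupp.linearCombination (ZMod 2) f

/-- The boundary of the chain `c` is `p + q`, expressed by duality. -/
def IsChainPath (c : GridEdge →₀ ZMod 2) (p q : ℤ × ℤ) : Prop :=
  ∀ κ, chainEval (cobdry κ) c = κ p + κ q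

/-- All edges of the chain `c` have both ends in `S`. -/
def ChainIn (c : GridEdge →₀ ZMod 2) (S : Set (ℤ × ℤ)) : Prop :=
  ∀ g, c g ≠ 0 → g.src ∈ S ∧ g.tgt ∈ S

lemma isChainPath_zero (p : ℤ × ℤ) : IsChainPath 0 p p := by
  intro κ
  simp [CharTwo.add_self_eq_zero]

lemma IsChainPath.add_edge {c : GridEdge →₀ ZMod 2} {p q r : ℤ × ℤ} {g : GridEdge}
    (hc : IsChainPath c p q) (hg : g.Joins q r) :
    IsChainPath (c + Finsupp.single g 1) p r := by
  intro κ
  rw [map_add, hc κ, Finsupp.linearCombination_single, hg.cobdry_eq, one_smul]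
  linear_combination (κ q) * (CharTwo.two_eq_zero (R := ZMod 2))

lemma chainIn_zero (S : Set (ℤ × ℤ)) : ChainIn 0 S := fun _ hg => absurd rfl hg

lemma ChainIn.add_edge {c : GridEdge →₀ ZMod 2} {S : Set (ℤ × ℤ)} {g : GridEdge} {p q : ℤ × ℤ}
    (hc : ChainIn c S) (hg : g.Joins p q) (hp : p ∈ S) (hq : q ∈ S) :
    ChainIn (c + Finsupp.single g 1) S := by
  classical
  intro g' hg'
  by_cases h : g = g'
  · subst h
    rcases hg with ⟨rfl, rfl⟩ | ⟨rfl, rfl⟩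
    · exact ⟨hp, hq⟩
    · exact ⟨hq, hp⟩
  · apply hc
    simpa [Finsupp.single_apply, h] using hg'

/-- The number, mod 2, of horizontal edges of `c` above a given face. -/
noncomputable def edgesAbove (c : GridEdge →₀ ZMod 2) (p : ℤ × ℤ) : ZMod 2 :=
  chainEval (fun g => match g with
    | hor x y => if x = p.1 ∧ p.2 < y then 1 else 0
    | ver _ _ => 0) c

open Classical in
lemma chainEval_ite (c : GridEdge →₀ ZMod 2) (g : GridEdge) :
    chainEval (fun g' => if g' = g then 1 else 0) c = c g := by
  rw [chainEval, Finsupp.linearCombination_apply, Finsupp.sum]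
  simp only [smul_eq_mul, mul_ite, mul_one, mul_zero, Finset.sum_ite_eq']
  split_ifs with h
  · rfl
  · exact (Finsupp.notMem_support_iff.mp h).symm

lemma chainEval_add (f f' : GridEdge → ZMod 2) (c : GridEdge →₀ ZMod 2) :
    chainEval (fun g => f g + f' g) c = chainEval f c + chainEval f' c := by
  simp [chainEval, Finsupp.linearCombination_apply, Finsupp.sum, mul_add, Finset.sum_add_distrib]

lemma hor_eq_edgesAbove (c : GridEdge →₀ ZMod 2) (x y : ℤ) :
    c (hor x y) = edgesAbove c (x, y) + edgesAbove c (x, y - 1) := by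
  classical
  rw [edgesAbove, edgesAbove, ← chainEval_add, ← chainEval_ite c (hor x y)]
  congr 2
  funext g
  rcases g with ⟨a, b⟩ | ⟨a, b⟩
  · by_cases ha : a = x
    · subst ha
      rcases lt_trichotomy b y with h | h | h
      · simp [h.ne, h.not_gt, show ¬ y ≤ b by omega]
      · simp [h]
      · simp [h.ne', h, h.le, CharTwo.add_self_eq_zero]
    · simp [ha]
  · simp

lemma IsChainPath.ver_eq_edgesAbove {c : GridEdge →₀ ZMod 2} {p q : ℤ × ℤ}
    (hc : IsChainPath c p q) (x y : ℤ) :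
    c (ver x y) = edgesAbove c (x, y) + edgesAbove c (x - 1, y) +
      ((if p.1 = x ∧ y < p.2 then 1 else 0) + (if q.1 = x ∧ y < q.2 then 1 else 0)) := by
  classical
  have h := hc (fun r => if r.1 = x ∧ y < r.2 then 1 else 0)
  rw [← h, edgesAbove, edgesAbove, ← chainEval_add, ← chainEval_add,
    ← chainEval_ite c (ver x y)]
  congr 2
  funext g
  rcases g with ⟨a, b⟩ | ⟨a, b⟩
  · have e : a = x - 1 ↔ a + 1 = x := by omega
    simp only [cobdry, src, tgt, e, reduceCtorEq, if_false]
    by_cases h1 : a = x <;> by_cases h2 : a + 1 = x <;> by_cases h3 : y < b <;>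
      simp [h1, h2, h3, CharTwo.add_self_eq_zero]
  · simp only [cobdry, src, tgt, GridEdge.ver.injEq]
    by_cases ha : a = x
    · subst ha
      rcases lt_trichotomy b y with h | h | h
      · simp [h.ne, h.not_gt, show ¬ y < b + 1 by omega]
      · simp [h]
      · simp [h.ne', h, show y < b + 1 by omega, CharTwo.add_self_eq_zero]
    · simp [ha]

/-- Every mod 2 cycle of the grid is a sum of face boundaries. -/
lemma eq_faceBdry_edgesAbove {c : GridEdge →₀ ZMod 2} (hc : ∀ κ, chainEval (cobdry κ) c = 0)
    (g : GridEdge) : c g = faceBdry (edgesAbove c) g := by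
  classical
  rcases g with ⟨x, y⟩ | ⟨x, y⟩
  · exact hor_eq_edgesAbove c x y
  · have h : IsChainPath c 0 0 := fun κ => by rw [hc, CharTwo.add_self_eq_zero]
    rw [h.ver_eq_edgesAbove, CharTwo.add_self_eq_zero, add_zero]
    rfl

/-- The coboundary of a finitely supported function pairs to zero with every face boundary. -/
lemma exists_cobdry_chain (w : ℤ × ℤ → ZMod 2) (κ : ℤ × ℤ →₀ ZMod 2) :
    ∃ c : GridEdge →₀ ZMod 2, (∀ g, c g = cobdry κ g) ∧ chainEval (faceBdry w) c = 0 := by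
  classical
  induction κ using Finsupp.induction_linear with
  | zero => exact ⟨0, fun g => by simp [cobdry], by simp⟩
  | add κ κ' h h' =>
    obtain ⟨c, hc, hw⟩ := h
    obtain ⟨c', hc', hw'⟩ := h'
    refine ⟨c + c', fun g => ?_, by rw [map_add, hw, hw', add_zero]⟩
    simp only [Finsupp.add_apply, hc, hc', cobdry]
    ring
  | single p a =>
    obtain ⟨x, y⟩ := p
    refine ⟨Finsupp.single (hor x y) a + Finsupp.single (hor (x - 1) y) a +
      Finsupp.single (ver x y) a + Finsupp.single (ver x (y - 1)) a, fun g => ?_, ?_⟩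
    · rcases g with ⟨i, j⟩ | ⟨i, j⟩
      · have e : x - 1 = i ↔ x = i + 1 := by omega
        simp [Finsupp.single_apply, cobdry, src, tgt, e]
      · have e : y - 1 = j ↔ y = j + 1 := by omega
        simp [Finsupp.single_apply, cobdry, src, tgt, e]
    · simp only [chainEval, map_add, Finsupp.linearCombination_single, faceBdry, faceA, faceB,
        smul_eq_mul]
      linear_combination (a * (w (x, y) + w (x, y - 1) + w (x - 1, y) + w (x - 1, y - 1))) *
        (CharTwo.two_eq_zero (R := ZMod 2))

/-! ### A counting bound for graphs with a plane dual -/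

/-- The mod 2 cycle space of the multigraph with edges `e` joining `s e` to `t e`, expressed by
duality. -/
def CycleSpace {V E : Type*} [Fintype E] (s t : E → V) : Set (E → ZMod 2) :=
  {z | ∀ f : V → ZMod 2, ∑ e, z e * (f (s e) + f (t e)) = 0}

/-- If the space `Z` of edge sets is the cut space of a graph on `F`, then Euler's formula bounds
the dimension of `Z` in terms of the minimum size of its nonzero members. -/
lemma card_bound_of_dual {E F D : Type*} [Fintype E] [Nonempty E] [Fintype D]
    (Z : Set (E → ZMod 2)) (l r : E → F)
    (hlift : ∀ z ∈ Z, ∃ w : F → ZMod 2, ∀ e, z e = w (l e) + w (r e))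
    (hcut : ∀ w : F → ZMod 2, (fun e => w (l e) + w (r e)) ∈ Z)
    (m : ℕ) (hm : ∀ z ∈ Z, ∀ e, z e ≠ 0 → ∃ T : Finset E, m ≤ T.card ∧ ∀ e' ∈ T, z e' ≠ 0)
    (cyc : (D → ZMod 2) → E → ZMod 2) (hcyc : Function.Injective cyc)
    (hcycZ : ∀ x, cyc x ∈ Z) (hcov : ∀ e, ∃ x, cyc x e ≠ 0) :
    m * (Fintype.card D + 1) ≤ 2 * Fintype.card E := by
  classical
  have hlr : ∀ e, l e ≠ r e := by
    intro e he
    obtain ⟨x, hx⟩ := hcov e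
    obtain ⟨w, hw⟩ := hlift _ (hcycZ x)
    exact hx (by rw [hw, he, CharTwo.add_self_eq_zero])
  set A : Finset F := Finset.univ.image l ∪ Finset.univ.image r with hA
  have hlA : ∀ e, l e ∈ A := fun e => by simp [hA]
  have hrA : ∀ e, r e ∈ A := fun e => by simp [hA]
  have hdeg : ∀ f ∈ A, m ≤ (Finset.univ.filter fun e => l e = f ∨ r e = f).card := by
    intro f hf
    have hz := hcut (Pi.single f 1)
    obtain ⟨e, he⟩ : ∃ e, l e = f ∨ r e = f := by
      simp only [hA, Finset.mem_union, Finset.mem_image, Finset.mem_univ, true_and] at hf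
      rcases hf with ⟨e, he⟩ | ⟨e, he⟩
      · exact ⟨e, Or.inl he⟩
      · exact ⟨e, Or.inr he⟩
    have hne := hlr e
    obtain ⟨T, hT, hT'⟩ := hm _ hz e (by
      rcases he with rfl | rfl
      · simp [hne.symm]
      · simp [hne])
    refine hT.trans (Finset.card_le_card fun e' he' => ?_)
    have := hT' e' he'
    simp only [Finset.mem_filter, Finset.mem_univ, true_and]
    by_contra! hcon
    simp [hcon.1, hcon.2] at this
  have hcount : m * A.card ≤ 2 * Fintype.card E := by
    calc m * A.card = ∑ _f ∈ A, m := by simp [mul_comm]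
      _ ≤ ∑ f ∈ A, (Finset.univ.filter fun e => l e = f ∨ r e = f).card :=
        Finset.sum_le_sum hdeg
      _ = ∑ e : E, (A.filter fun f => l e = f ∨ r e = f).card :=
        Finset.sum_card_bipartiteAbove_eq_sum_card_bipartiteBelow _
      _ ≤ ∑ _e : E, 2 := by
        refine Finset.sum_le_sum fun e _ => ?_
        refine (Finset.card_le_card (t := {l e, r e}) fun f hf => ?_).trans Finset.card_le_two
        simp only [Finset.mem_filter] at hf
        simp only [Finset.mem_insert, Finset.mem_singleton]
        exact hf.2.imp Eq.symm Eq.symm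
      _ = 2 * Fintype.card E := by simp [mul_comm]
  obtain ⟨e₀⟩ := ‹Nonempty E›
  have hnorm : ∀ x, ∃ w : F → ZMod 2, w (l e₀) = 0 ∧ ∀ e, cyc x e = w (l e) + w (r e) := by
    intro x
    obtain ⟨w, hw⟩ := hlift _ (hcycZ x)
    refine ⟨fun f => w f + w (l e₀), CharTwo.add_self_eq_zero _, fun e => ?_⟩
    rw [hw]
    linear_combination (-w (l e₀)) * (CharTwo.two_eq_zero (R := ZMod 2))
  choose w hw₀ hw using hnorm
  have hinj : Function.Injective
      fun (x : D → ZMod 2) (f : (A.erase (l e₀) : Finset F)) => w x f := by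
    intro x x' hxx
    have key : ∀ f ∈ A, w x f = w x' f := by
      intro f hf
      by_cases h : f = l e₀
      · rw [h, hw₀, hw₀]
      · exact congrFun hxx ⟨f, Finset.mem_erase.mpr ⟨h, hf⟩⟩
    apply hcyc
    funext e
    rw [hw, hw, key _ (hlA e), key _ (hrA e)]
  have hcard := Fintype.card_le_of_injective _ hinj
  simp only [Fintype.card_fun, ZMod.card, Fintype.card_coe,
    Finset.card_erase_of_mem (hlA e₀)] at hcard
  have hle : Fintype.card D ≤ A.card - 1 := (Nat.pow_le_pow_iff_right (by norm_num)).mp hcard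
  have hpos : 0 < A.card := Finset.card_pos.mpr ⟨_, hlA e₀⟩
  exact (Nat.mul_le_mul_left m (by omega)).trans hcount

/-- A mod 2 cycle that uses an edge at `v` uses another edge at `v`. -/
lemma CycleSpace.exists_other {V E : Type*} [Fintype E] {s t : E → V} (hst : ∀ e, s e ≠ t e)
    {z : E → ZMod 2} (hz : z ∈ CycleSpace s t) {e : E} (he : z e ≠ 0) {v : V}
    (hv : s e = v ∨ t e = v) : ∃ e', e' ≠ e ∧ z e' ≠ 0 ∧ (s e' = v ∨ t e' = v) := by
  classical
  by_contra! hcon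
  have h := hz (Pi.single v 1)
  rw [Finset.sum_eq_single e] at h
  · have hne := hst e
    rcases hv with rfl | rfl
    · simp [hne.symm, he] at h
    · simp [hne, he] at h
  · intro e' _ hne
    by_cases hz' : z e' = 0
    · simp [hz']
    · obtain ⟨h1, h2⟩ := hcon e' hne hz'
      simp [h1, h2]
  · simp

/-- The `k`-th edge of `K₅` joins `k5Src k` to `k5Tgt k`. -/
def k5Src : Fin 10 → Fin 5 := ![0, 0, 0, 0, 1, 1, 1, 2, 2, 3]

def k5Tgt : Fin 10 → Fin 5 := ![1, 2, 3, 4, 2, 3, 4, 3, 4, 4]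

/-- The cycles of `K₅`, parametrized by their edges outside of the star at `0`. -/
def k5Cycle (x : Fin 6 → ZMod 2) : Fin 10 → ZMod 2 :=
  ![x 0 + x 1 + x 2, x 0 + x 3 + x 4, x 1 + x 3 + x 5, x 2 + x 4 + x 5,
    x 0, x 1, x 2, x 3, x 4, x 5]

lemma k5_no_dual {F : Type*} (l r : Fin 10 → F)
    (hlift : ∀ z ∈ CycleSpace k5Src k5Tgt, ∃ w : F → ZMod 2, ∀ e, z e = w (l e) + w (r e))
    (hcut : ∀ w : F → ZMod 2, (fun e => w (l e) + w (r e)) ∈ CycleSpace k5Src k5Tgt) :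
    False := by
  classical
  have hst : ∀ e, k5Src e ≠ k5Tgt e := by decide
  have hsimple : ∀ e e', (k5Src e' = k5Src e ∨ k5Tgt e' = k5Src e) →
      (k5Src e' = k5Tgt e ∨ k5Tgt e' = k5Tgt e) → e' = e := by decide
  have h := card_bound_of_dual (D := Fin 6) (CycleSpace k5Src k5Tgt) l r hlift hcut 3 ?_ k5Cycle
    ?_ ?_ ?_
  · simp at h
  · intro z hz e he
    obtain ⟨e₁, hne₁, hz₁, hv₁⟩ := CycleSpace.exists_other hst hz he (Or.inl rfl)
    obtain ⟨e₂, hne₂, hz₂, hv₂⟩ := CycleSpace.exists_other hst hz he (Or.inr rfl)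
    have hne : e₁ ≠ e₂ := fun h => hne₁ (hsimple _ _ hv₁ (h ▸ hv₂))
    refine ⟨{e, e₁, e₂}, ?_, ?_⟩
    · rw [Finset.card_eq_three.mpr ⟨e, e₁, e₂, hne₁.symm, hne₂.symm, hne, rfl⟩]
    · simp [he, hz₁, hz₂]
  · intro x y hxy
    funext i
    have key : ∀ (x : Fin 6 → ZMod 2) (i : Fin 6), k5Cycle x (Fin.natAdd 4 i) = x i := by
      intro x i
      fin_cases i <;> rfl
    rw [← key x, ← key y, hxy]
  · intro x f
    simp only [Fin.sum_univ_succ, k5Cycle, k5Src, k5Tgt]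
    simp
    linear_combination (x 0 * (f 0 + f 1 + f 2) + x 1 * (f 0 + f 1 + f 3)
      + x 2 * (f 0 + f 1 + f 4) + x 3 * (f 0 + f 2 + f 3) + x 4 * (f 0 + f 2 + f 4)
      + x 5 * (f 0 + f 3 + f 4)) * (CharTwo.two_eq_zero (R := ZMod 2))
  · intro e
    fin_cases e
    exacts [⟨Pi.single 0 1, by decide⟩, ⟨Pi.single 0 1, by decide⟩, ⟨Pi.single 1 1, by decide⟩,
      ⟨Pi.single 2 1, by decide⟩, ⟨Pi.single 0 1, by decide⟩, ⟨Pi.single 1 1, by decide⟩,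
      ⟨Pi.single 2 1, by decide⟩, ⟨Pi.single 3 1, by decide⟩, ⟨Pi.single 4 1, by decide⟩,
      ⟨Pi.single 5 1, by decide⟩]

def k33Src (e : Fin 3 × Fin 3) : Fin 3 ⊕ Fin 3 := Sum.inl e.1

def k33Tgt (e : Fin 3 × Fin 3) : Fin 3 ⊕ Fin 3 := Sum.inr e.2

/-- The cycles of `K₃,₃`, parametrized by their edges avoiding the last vertex on both sides. -/
def k33Cycle (x : Fin 4 → ZMod 2) (e : Fin 3 × Fin 3) : ZMod 2 :=
  ![![x 0, x 1, x 0 + x 1], ![x 2, x 3, x 2 + x 3],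
    ![x 0 + x 2, x 1 + x 3, x 0 + x 1 + x 2 + x 3]] e.1 e.2

lemma k33_no_dual {F : Type*} (l r : Fin 3 × Fin 3 → F)
    (hlift : ∀ z ∈ CycleSpace k33Src k33Tgt, ∃ w : F → ZMod 2, ∀ e, z e = w (l e) + w (r e))
    (hcut : ∀ w : F → ZMod 2, (fun e => w (l e) + w (r e)) ∈ CycleSpace k33Src k33Tgt) :
    False := by
  classical
  have hst : ∀ e, k33Src e ≠ k33Tgt e := by simp [k33Src, k33Tgt]
  have h := card_bound_of_dual (D := Fin 4) (CycleSpace k33Src k33Tgt) l r hlift hcut 4 ?_ k33Cycle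
    ?_ ?_ ?_
  · simp at h
  · rintro z hz ⟨i, j⟩ he
    obtain ⟨⟨i₁, j₁⟩, hne₁, hz₁, hv₁⟩ :=
      CycleSpace.exists_other hst hz he (v := Sum.inl i) (Or.inl rfl)
    obtain ⟨⟨i₂, j₂⟩, hne₂, hz₂, hv₂⟩ :=
      CycleSpace.exists_other hst hz he (v := Sum.inr j) (Or.inr rfl)
    obtain ⟨⟨i₃, j₃⟩, hne₃, hz₃, hv₃⟩ :=
      CycleSpace.exists_other hst hz hz₂ (v := Sum.inl i₂) (Or.inl rfl)
    simp only [k33Src, k33Tgt, Sum.inl.injEq, Sum.inr.injEq, reduceCtorEq, or_false,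
      false_or] at hv₁ hv₂ hv₃
    subst hv₁ hv₂ hv₃
    simp only [ne_eq, Prod.mk.injEq, true_and, and_true] at hne₁ hne₂ hne₃
    refine ⟨{(i₁, j₂), (i₁, j₁), (i₃, j₂), (i₃, j₃)}, ?_, ?_⟩
    · rw [Finset.card_insert_of_notMem, Finset.card_eq_three.mpr ⟨_, _, _, ?_, ?_, ?_, rfl⟩]
      all_goals simp [Ne.symm hne₁, Ne.symm hne₂, Ne.symm hne₃]
    · simp [he, hz₁, hz₂, hz₃]
  · intro x y hxy
    have h0 := congrFun hxy (0, 0)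
    have h1 := congrFun hxy (0, 1)
    have h2 := congrFun hxy (1, 0)
    have h3 := congrFun hxy (1, 1)
    funext i
    fin_cases i
    exacts [h0, h1, h2, h3]
  · intro x f
    simp only [Fintype.sum_prod_type, Fin.sum_univ_three, k33Cycle, k33Src, k33Tgt]
    simp
    generalize f (Sum.inl 0) = a0, f (Sum.inl 1) = a1, f (Sum.inl 2) = a2
    generalize f (Sum.inr 0) = b0, f (Sum.inr 1) = b1, f (Sum.inr 2) = b2
    linear_combination (x 0 * (a0 + b0 + b2 + a2) + x 1 * (a0 + b1 + b2 + a2)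
      + x 2 * (a1 + b0 + b2 + a2) + x 3 * (a1 + b1 + b2 + a2)) *
        (CharTwo.two_eq_zero (R := ZMod 2))
  · rintro ⟨i, j⟩
    refine ⟨Pi.single (if i = 1 then (if j = 1 then 3 else 2) else if j = 1 then 1 else 0) 1, ?_⟩
    revert i j
    decide

/-! ### The plane dual of a minor of the square grid -/

/-- The vertex set `S` is joined by mod 2 paths inside of `S`. -/
def ChainConnected (S : Set (ℤ × ℤ)) : Prop :=
  ∃ x ∈ S, ∀ y ∈ S, ∃ c, IsChainPath c x y ∧ ChainIn c S

/-- If a graph has a model with branch sets `S v` in the square grid, then its cycle space is the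
cut space of a graph, whose vertices are the classes of grid faces that are not separated by
edges of the model. -/
lemma exists_dual_of_grid_model {V E : Type*} [Fintype E] (s t : E → V)
    (hst : ∀ e, s e ≠ t e)
    (hsimple : ∀ e e', (s e' = s e ∨ t e' = s e) → (s e' = t e ∨ t e' = t e) → e' = e)
    (S : V → Set (ℤ × ℤ)) (hdisj : ∀ u v, ∀ p ∈ S u, p ∈ S v → u = v)
    (hconn : ∀ v, ChainConnected (S v))
    (hadj : ∀ e, ∃ a ∈ S (s e), ∃ b ∈ S (t e), ∃ g : GridEdge, g.Joins a b) :
    ∃ (F : Type) (l r : E → F),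
      (∀ z ∈ CycleSpace s t, ∃ w : F → ZMod 2, ∀ e, z e = w (l e) + w (r e)) ∧
      ∀ w : F → ZMod 2, (fun e => w (l e) + w (r e)) ∈ CycleSpace s t := by
  classical
  choose x hx hpath using hconn
  choose a ha b hb ε hε using hadj
  choose ca hca hcaS using fun e => hpath (s e) (a e) (ha e)
  choose cb hcb hcbS using fun e => hpath (t e) (b e) (hb e)
  have hεends : ∀ e v, (ε e).src ∈ S v → (ε e).tgt ∈ S v → False := by
    intro e v h1 h2
    apply hst e
    rcases hε e with ⟨h, h'⟩ | ⟨h, h'⟩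
    · exact (hdisj _ _ _ (ha e) (h ▸ h1)).trans (hdisj _ _ _ (hb e) (h' ▸ h2)).symm
    · exact (hdisj _ _ _ (ha e) (h' ▸ h2)).trans (hdisj _ _ _ (hb e) (h ▸ h1)).symm
  have hεinj : ∀ e e', ε e' = ε e → e' = e := by
    intro e e' h
    have h1 := hε e
    have h2 := hε e'
    rw [h] at h2
    have hab : (a e = a e' ∧ b e = b e') ∨ (a e = b e' ∧ b e = a e') := by
      rcases h1 with ⟨h1, h1'⟩ | ⟨h1, h1'⟩ <;> rcases h2 with ⟨h2, h2'⟩ | ⟨h2, h2'⟩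
      · exact Or.inl ⟨h1.symm.trans h2, h1'.symm.trans h2'⟩
      · exact Or.inr ⟨h1.symm.trans h2, h1'.symm.trans h2'⟩
      · exact Or.inr ⟨h1'.symm.trans h2', h1.symm.trans h2⟩
      · exact Or.inl ⟨h1'.symm.trans h2', h1.symm.trans h2⟩
    rcases hab with ⟨h3, h4⟩ | ⟨h3, h4⟩
    · exact hsimple e e' (Or.inl (hdisj _ _ _ (ha e') (h3 ▸ ha e)))
        (Or.inr (hdisj _ _ _ (hb e') (h4 ▸ hb e)))
    · exact hsimple e e' (Or.inr (hdisj _ _ _ (hb e') (h3 ▸ ha e)))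
        (Or.inl (hdisj _ _ _ (ha e') (h4 ▸ hb e)))
  set K : Finset GridEdge :=
    Finset.univ.biUnion fun e => (ca e).support ∪ (cb e).support ∪ {ε e} with hK
  have hKmem : ∀ g, g ∈ K ↔ ∃ e, ca e g ≠ 0 ∨ cb e g ≠ 0 ∨ g = ε e := by
    intro g
    simp only [hK, Finset.mem_biUnion, Finset.mem_univ, true_and, Finset.mem_union,
      Finsupp.mem_support_iff, Finset.mem_singleton, or_assoc]
  let rel : ℤ × ℤ → ℤ × ℤ → Prop := fun p q => ∃ g, g ∉ K ∧ p = g.faceA ∧ q = g.faceB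
  refine ⟨Quot rel, fun e => Quot.mk _ (ε e).faceA, fun e => Quot.mk _ (ε e).faceB, ?_, ?_⟩
  · intro z hz
    set c : GridEdge →₀ ZMod 2 :=
      ∑ e, z e • (ca e + Finsupp.single (ε e) 1 + cb e) with hc
    have hcyc : ∀ κ, chainEval (cobdry κ) c = 0 := by
      intro κ
      rw [← hz (fun v => κ (x v)), hc, map_sum]
      refine Finset.sum_congr rfl fun e _ => ?_
      rw [map_smul, map_add, map_add, hca e κ, hcb e κ, Finsupp.linearCombination_single,
        (hε e).cobdry_eq, smul_eq_mul, one_smul]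
      linear_combination (z e * (κ (a e) + κ (b e))) * (CharTwo.two_eq_zero (R := ZMod 2))
    have hcK : ∀ g, g ∉ K → c g = 0 := by
      intro g hg
      simp only [hKmem, not_exists, not_or, not_not] at hg
      rw [hc, Finsupp.finsetSum_apply]
      refine Finset.sum_eq_zero fun e _ => ?_
      obtain ⟨h1, h2, h3⟩ := hg e
      simp [h1, h2, Ne.symm h3]
    have hcε : ∀ e, c (ε e) = z e := by
      intro e
      rw [hc, Finsupp.finsetSum_apply, Finset.sum_eq_single e]
      · have h1 : ca e (ε e) = 0 := by
          by_contra h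
          exact hεends _ _ (hcaS e _ h).1 (hcaS e _ h).2
        have h2 : cb e (ε e) = 0 := by
          by_contra h
          exact hεends _ _ (hcbS e _ h).1 (hcbS e _ h).2
        simp [h1, h2]
      · intro e' _ hne
        have h1 : ca e' (ε e) = 0 := by
          by_contra h
          exact hεends _ _ (hcaS e' _ h).1 (hcaS e' _ h).2
        have h2 : cb e' (ε e) = 0 := by
          by_contra h
          exact hεends _ _ (hcbS e' _ h).1 (hcbS e' _ h).2
        have h3 : ε e' ≠ ε e := fun h => hne (hεinj _ _ h)
        simp [h1, h2, h3]
      · simp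
    refine ⟨Quot.lift (edgesAbove c) ?_, fun e => ?_⟩
    · rintro p q ⟨g, hg, rfl, rfl⟩
      have h := eq_faceBdry_edgesAbove hcyc g
      rw [hcK g hg] at h
      exact CharTwo.add_eq_zero.mp h.symm
    · rw [← hcε e]
      exact eq_faceBdry_edgesAbove hcyc _
  · intro w f
    let w' : ℤ × ℤ → ZMod 2 := fun p => w (Quot.mk _ p)
    have hw' : ∀ g, g ∉ K → faceBdry w' g = 0 := by
      intro g hg
      have : (Quot.mk rel g.faceA) = Quot.mk rel g.faceB := Quot.sound ⟨g, hg, rfl, rfl⟩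
      simp only [faceBdry, w', this, CharTwo.add_self_eq_zero]
    let T : Finset (ℤ × ℤ) := K.image src ∪ K.image tgt
    let κ₀ : ℤ × ℤ → ZMod 2 := fun p => if h : ∃ v, p ∈ S v then f h.choose else 0
    have hκ₀ : ∀ v, ∀ p ∈ S v, κ₀ p = f v := by
      intro v p hp
      have h : ∃ v, p ∈ S v := ⟨v, hp⟩
      simp only [κ₀, dif_pos h]
      rw [hdisj _ _ p h.choose_spec hp]
    let κ : ℤ × ℤ →₀ ZMod 2 := Finsupp.onFinset T (fun p => if p ∈ T then κ₀ p else 0)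
      (fun p hp => by by_contra h; simp [h] at hp)
    have hκ : ∀ p ∈ T, κ p = κ₀ p := by
      intro p hp
      simp [κ, hp]
    have hcob : ∀ g ∈ K, cobdry κ g = cobdry κ₀ g := by
      intro g hg
      rw [cobdry, hκ _ (Finset.mem_union_left _ (Finset.mem_image_of_mem _ hg)),
        hκ _ (Finset.mem_union_right _ (Finset.mem_image_of_mem _ hg)), cobdry]
    have hεK : ∀ e, ε e ∈ K := fun e => (hKmem _).2 ⟨e, Or.inr (Or.inr rfl)⟩
    obtain ⟨c, hc, hzero⟩ := exists_cobdry_chain w' κ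
    rw [← hzero, chainEval, Finsupp.linearCombination_apply, Finsupp.sum]
    have hsum : ∀ g, g ∉ Finset.univ.image ε → c g • faceBdry w' g = 0 := by
      intro g hg
      by_cases hgK : g ∈ K
      · obtain ⟨e, h | h | h⟩ := (hKmem g).1 hgK
        · have := hcaS e g h
          rw [hc, hcob g hgK, cobdry, hκ₀ _ _ this.1, hκ₀ _ _ this.2,
            CharTwo.add_self_eq_zero, zero_smul]
        · have := hcbS e g h
          rw [hc, hcob g hgK, cobdry, hκ₀ _ _ this.1, hκ₀ _ _ this.2,
            CharTwo.add_self_eq_zero, zero_smul]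
        · exact absurd (Finset.mem_image.mpr ⟨e, Finset.mem_univ _, h.symm⟩) hg
      · rw [hw' g hgK, smul_zero]
    have h1 : ∑ g ∈ c.support, c g • faceBdry w' g =
        ∑ g ∈ Finset.univ.image ε, c g • faceBdry w' g := by
      trans ∑ g ∈ c.support ∪ Finset.univ.image ε, c g • faceBdry w' g
      · refine Finset.sum_subset Finset.subset_union_left fun g _ hg => ?_
        rw [Finsupp.notMem_support_iff.mp hg, zero_smul]
      · exact (Finset.sum_subset Finset.subset_union_right fun g _ hg => hsum g hg).symm
    rw [h1, Finset.sum_image fun e _ e' _ h => hεinj _ _ h]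
    refine Finset.sum_congr rfl fun e _ => ?_
    rw [hc, hcob _ (hεK e), (hε e).cobdry_eq, hκ₀ _ _ (ha e), hκ₀ _ _ (hb e), smul_eq_mul,
      mul_comm]
    rfl

/-! ### Connected sets in `GraphG` and their traces on the half-grid -/

/-- A form of connectedness of the vertex set `S` suited to propagating properties. -/
def Propagates {β : Type*} (G : SimpleGraph β) (S : Set β) : Prop :=
  ∀ P : β → Prop, (∃ x ∈ S, P x) → (∀ x ∈ S, ∀ y ∈ S, G.Adj x y → P x → P y) → ∀ y ∈ S, P y

lemma propagates_of_preconnected {β : Type*} {G : SimpleGraph β} {S : Set β}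
    (h : (G.induce S).Preconnected) : Propagates G S := by
  rintro P ⟨x, hx, hPx⟩ hstep y hy
  obtain ⟨p⟩ := h ⟨x, hx⟩ ⟨y, hy⟩
  suffices ∀ (u v : S), (G.induce S).Walk u v → P u → P v from this _ _ p hPx
  intro u v p
  induction p with
  | nil => exact id
  | cons hadj _ ih => exact fun hu => ih (hstep _ (Subtype.prop _) _ (Subtype.prop _) hadj hu)

lemma IsMinorModel.propagates_iUnion {α β : Type*} {X : SimpleGraph α} {G : SimpleGraph β}
    {B : α → Set β} (hB : IsMinorModel X G B) (hX : Propagates X Set.univ) :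
    Propagates G (⋃ v, B v) := by
  rintro P ⟨x, hx, hPx⟩ hstep y hy
  have hprop : ∀ v, (∃ x ∈ B v, P x) → ∀ x ∈ B v, P x := fun v hv =>
    propagates_of_preconnected (hB.connected v).preconnected P hv fun x hx y hy =>
      hstep x (Set.mem_iUnion_of_mem v hx) y (Set.mem_iUnion_of_mem v hy)
  obtain ⟨v, hv⟩ := Set.mem_iUnion.mp hx
  obtain ⟨u, hu⟩ := Set.mem_iUnion.mp hy
  refine hX (fun v => ∀ x ∈ B v, P x) ⟨v, trivial, hprop v ⟨x, hv, hPx⟩⟩ ?_ u trivial y hu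
  intro v _ u _ hadj hPv
  obtain ⟨a, ha, b, hb, hab⟩ := hB.adj hadj
  exact hprop u ⟨b, hb, hstep a (Set.mem_iUnion_of_mem v ha) b (Set.mem_iUnion_of_mem u hb) hab
    (hPv a ha)⟩

lemma IsMinorModel.comp {α α' β : Type*} {X : SimpleGraph α} {Y : SimpleGraph α'}
    {G : SimpleGraph β} {B : α → Set β} (hB : IsMinorModel X G B) (φ : α' → α)
    (hφ : Function.Injective φ) (hadj : ∀ u v, Y.Adj u v → X.Adj (φ u) (φ v)) :
    IsMinorModel Y G (B ∘ φ) where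
  nonempty v := hB.nonempty (φ v)
  connected v := hB.connected (φ v)
  pairwise_disjoint _ _ h := hB.pairwise_disjoint (hφ.ne h)
  adj _ _ h := hB.adj (hadj _ _ h)

lemma IsMinorModel.eq_of_mem {α β : Type*} {X : SimpleGraph α} {G : SimpleGraph β}
    {B : α → Set β} (hB : IsMinorModel X G B) {u v : α} {x : β} (hu : x ∈ B u) (hv : x ∈ B v) :
    u = v := by
  by_contra h
  exact Set.disjoint_left.mp (hB.pairwise_disjoint h) hu hv

/-- The retraction of `GraphG` onto the half-grid, seen inside of `ℤ × ℤ`. -/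
def gridProj : GV → ℤ × ℤ
  | Sum.inl p => (p.1, p.2)
  | Sum.inr (Sum.inl w) => (w.1.1, 0)
  | Sum.inr (Sum.inr w) => (w.1.1, 0)

/-- The vertices of `S` on the half-grid, seen inside of `ℤ × ℤ`. -/
def gridTrace (S : Set GV) : Set (ℤ × ℤ) :=
  {p | ∃ q : ℤ × ℕ, Sum.inl q ∈ S ∧ gridProj (Sum.inl q) = p}

/-- The vertices added to the half-grid at `p`. -/
def Gadget (p : ℤ × ℤ) : Set GV := {x | gridProj x = p ∧ ∀ q, x ≠ Sum.inl q}

lemma gridProj_inl_injective {p q : ℤ × ℕ}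
    (h : gridProj (Sum.inl p) = gridProj (Sum.inl q)) : p = q := by
  simp only [gridProj, Prod.mk.injEq, Nat.cast_inj] at h
  exact Prod.ext h.1 h.2

lemma inl_mem_of_mem_gridTrace {S : Set GV} {q : ℤ × ℕ}
    (h : gridProj (Sum.inl q) ∈ gridTrace S) : Sum.inl q ∈ S := by
  obtain ⟨q', hq', h⟩ := h
  exact gridProj_inl_injective h ▸ hq'

lemma gridTrace_disjoint {S T : Set GV} (h : Disjoint S T) {p : ℤ × ℤ} (hS : p ∈ gridTrace S)
    (hT : p ∈ gridTrace T) : False := by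
  obtain ⟨q, hq, rfl⟩ := hS
  exact Set.disjoint_left.mp h hq (inl_mem_of_mem_gridTrace hT)

lemma GRel.gridProj {x y : GV} (h : GRel x y) : gridProj x = gridProj y ∨
    ∃ p q, x = Sum.inl p ∧ y = Sum.inl q ∧
      ∃ g : GridEdge, g.src = gridProj x ∧ g.tgt = gridProj y := by
  rcases x with p | w | w <;> rcases y with q | w' | w' <;> simp only [GRel] at h
  · refine Or.inr ⟨p, q, rfl, rfl, ?_⟩
    rcases h with ⟨h1, h2⟩ | ⟨h1, h2⟩
    · exact ⟨hor p.1 p.2, rfl, by simp [_root_.gridProj, tgt, h1, h2]⟩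
    · exact ⟨ver p.1 p.2, rfl, by simp [_root_.gridProj, tgt, h1, h2]⟩
  · left; simp [_root_.gridProj, h]
  · left; simp [_root_.gridProj, h.1]
  · left; simp [_root_.gridProj, h]
  · left; simp [_root_.gridProj, h.1]

lemma adj_gridProj {x y : GV} (h : GraphG.Adj x y) : gridProj x = gridProj y ∨
    ∃ p q, x = Sum.inl p ∧ y = Sum.inl q ∧ ∃ g : GridEdge, g.Joins (gridProj x) (gridProj y) := by
  rcases ((SimpleGraph.fromRel_adj _ _ _).mp h).2 with h | h
  · refine h.gridProj.imp id ?_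
    rintro ⟨p, q, hp, hq, g, hg⟩
    exact ⟨p, q, hp, hq, g, Or.inl hg⟩
  · refine h.gridProj.imp Eq.symm ?_
    rintro ⟨p, q, hp, hq, g, hg⟩
    exact ⟨q, p, hq, hp, g, Or.inr hg⟩

lemma Propagates.gridProj_mem {S : Set GV} (hS : Propagates GraphG S)
    (hgrid : ∃ q, Sum.inl q ∈ S) {x : GV} (hx : x ∈ S) : gridProj x ∈ gridTrace S := by
  obtain ⟨q, hq⟩ := hgrid
  refine hS (fun x => gridProj x ∈ gridTrace S) ⟨_, hq, q, hq, rfl⟩ ?_ x hx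
  intro x _ y hy hadj hPx
  rcases adj_gridProj hadj with h | ⟨_, q, _, rfl, _⟩
  · exact h ▸ hPx
  · exact ⟨q, hy, rfl⟩

lemma Propagates.exists_chain {S : Set GV} (hS : Propagates GraphG S) {q : ℤ × ℕ}
    (hq : Sum.inl q ∈ S) {y : GV} (hy : y ∈ S) :
    ∃ c, IsChainPath c (gridProj (Sum.inl q)) (gridProj y) ∧ ChainIn c (gridTrace S) := by
  refine hS (fun y => ∃ c, IsChainPath c (gridProj (Sum.inl q)) (gridProj y) ∧
    ChainIn c (gridTrace S)) ⟨_, hq, 0, isChainPath_zero _, chainIn_zero _⟩ ?_ y hy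
  rintro x hx y hy hadj ⟨c, hc, hcS⟩
  rcases adj_gridProj hadj with h | ⟨_, _, _, _, g, hg⟩
  · exact ⟨c, h ▸ hc, hcS⟩
  · exact ⟨_, hc.add_edge hg, hcS.add_edge hg (hS.gridProj_mem ⟨q, hq⟩ hx)
      (hS.gridProj_mem ⟨q, hq⟩ hy)⟩

lemma Propagates.chainConnected {S : Set GV} (hS : Propagates GraphG S)
    (hgrid : ∃ q, Sum.inl q ∈ S) : ChainConnected (gridTrace S) := by
  obtain ⟨q, hq⟩ := hgrid
  refine ⟨_, ⟨q, hq, rfl⟩, ?_⟩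
  rintro _ ⟨q', hq', rfl⟩
  exact hS.exists_chain hq hq'

lemma IsMinorModel.propagates {α β : Type*} {X : SimpleGraph α} {G : SimpleGraph β}
    {B : α → Set β} (hB : IsMinorModel X G B) (v : α) : Propagates G (B v) :=
  propagates_of_preconnected (hB.connected v).preconnected

/-- A model in `GraphG` all of whose branch sets meet the half-grid yields a plane dual. -/
lemma IsMinorModel.exists_dual {α E : Type*} [Fintype E] {X : SimpleGraph α} {B : α → Set GV}
    (hB : IsMinorModel X GraphG B) (hgrid : ∀ v, ∃ q, Sum.inl q ∈ B v) (s t : E → α)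
    (hst : ∀ e, X.Adj (s e) (t e))
    (hsimple : ∀ e e', (s e' = s e ∨ t e' = s e) → (s e' = t e ∨ t e' = t e) → e' = e) :
    ∃ (F : Type) (l r : E → F),
      (∀ z ∈ CycleSpace s t, ∃ w : F → ZMod 2, ∀ e, z e = w (l e) + w (r e)) ∧
      ∀ w : F → ZMod 2, (fun e => w (l e) + w (r e)) ∈ CycleSpace s t := by
  have hdisj : ∀ u v, ∀ p ∈ gridTrace (B u), p ∈ gridTrace (B v) → u = v := by
    intro u v p hu hv
    by_contra h
    exact gridTrace_disjoint (hB.pairwise_disjoint h) hu hv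
  refine exists_dual_of_grid_model s t (fun e => (hst e).ne) hsimple (fun v => gridTrace (B v))
    hdisj (fun v => (hB.propagates v).chainConnected (hgrid v)) fun e => ?_
  obtain ⟨x, hx, y, hy, hadj⟩ := hB.adj (hst e)
  have hx' := (hB.propagates _).gridProj_mem (hgrid _) hx
  have hy' := (hB.propagates _).gridProj_mem (hgrid _) hy
  rcases adj_gridProj hadj with h | ⟨_, _, _, _, g, hg⟩
  · exact absurd (hdisj _ _ _ hx' (h ▸ hy')) (hst e).ne
  · exact ⟨_, hx', _, hy', g, hg⟩

lemma Propagates.subset_gadget {S : Set GV} (hS : Propagates GraphG S) {p : ℤ × ℤ} {x : GV}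
    (hx : x ∈ S) (hxp : x ∈ Gadget p) (hp : p ∉ gridTrace S) : S ⊆ Gadget p := by
  refine hS (· ∈ Gadget p) ⟨x, hx, hxp⟩ ?_
  intro x _ y hy hadj hPx
  rcases adj_gridProj hadj with h | ⟨q, _, rfl, _⟩
  · refine ⟨h ▸ hPx.1, ?_⟩
    rintro q rfl
    exact hp ⟨q, hy, h ▸ hPx.1⟩
  · exact absurd rfl (hPx.2 q)

lemma Propagates.exists_subset_gadget {S : Set GV} (hS : Propagates GraphG S)
    (hne : S.Nonempty) (h : ¬ ∃ q, Sum.inl q ∈ S) : ∃ p, S ⊆ Gadget p := by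
  obtain ⟨x, hx⟩ := hne
  refine ⟨gridProj x, hS.subset_gadget hx ⟨rfl, ?_⟩ ?_⟩
  · rintro q rfl
    exact h ⟨q, hx⟩
  · rintro ⟨q, hq, _⟩
    exact h ⟨q, hq⟩

lemma IsMinorModel.subset_gadget_of_adj {α : Type*} {X : SimpleGraph α} {B : α → Set GV}
    (hB : IsMinorModel X GraphG B) {u v : α} (hadj : X.Adj v u) {p : ℤ × ℤ}
    (hv : B v ⊆ Gadget p) (hp : p ∉ gridTrace (B u)) : B u ⊆ Gadget p := by
  obtain ⟨x, hx, y, hy, hxy⟩ := hB.adj hadj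
  rcases adj_gridProj hxy with h | ⟨q, _, rfl, _⟩
  · refine (hB.propagates u).subset_gadget hy ⟨h ▸ (hv hx).1, ?_⟩ hp
    rintro q rfl
    exact hp ⟨q, hy, h ▸ (hv hx).1⟩
  · exact absurd rfl ((hv hx).2 q)

/-- Only one branch set contains a given grid vertex. -/
lemma IsMinorModel.exists_unique_trace {α : Type*} [Nonempty α] {X : SimpleGraph α}
    {B : α → Set GV} (hB : IsMinorModel X GraphG B) (p : ℤ × ℤ) :
    ∃ q, ∀ u, u ≠ q → p ∉ gridTrace (B u) := by
  by_cases h : ∃ q, p ∈ gridTrace (B q)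
  · obtain ⟨q, hq⟩ := h
    exact ⟨q, fun u hu hpu => gridTrace_disjoint (hB.pairwise_disjoint hu) hpu hq⟩
  · push Not at h
    exact ⟨Classical.arbitrary α, fun u _ => h u⟩

/-- The position of a vertex inside of its gadget. -/
def gadgetIndex : GV → ℕ
  | Sum.inl _ => 5
  | Sum.inr (Sum.inl w) => w.2
  | Sum.inr (Sum.inr w) => w.2

lemma gadgetIndex_le (x : GV) : gadgetIndex x ≤ 5 := by
  rcases x with p | w | w
  · exact le_rfl
  · exact w.2.2.le.trans (by norm_num)
  · exact w.2.2.le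

lemma gadgetIndex_lt {p : ℤ × ℤ} {x : GV} (hx : x ∈ Gadget p) : gadgetIndex x < 5 := by
  rcases x with q | w | w
  · exact absurd rfl (hx.2 q)
  · exact w.2.2.trans (by norm_num)
  · exact w.2.2

lemma gadgetIndex_lt_of_neg {p : ℤ × ℤ} {x : GV} (hx : x ∈ Gadget p) (hp : p.1 < 0) :
    gadgetIndex x < 4 := by
  obtain ⟨h, h'⟩ := hx
  rcases x with q | w | w
  · exact absurd rfl (h' q)
  · exact w.2.2
  · have := w.1.2
    rw [← h] at hp
    simp only [gridProj] at hp
    omega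

lemma eq_of_gridProj_of_gadgetIndex {x y : GV} (h : gridProj x = gridProj y)
    (hi : gadgetIndex x = gadgetIndex y) : x = y := by
  rcases x with p | w | w <;> rcases y with q | w' | w'
  · rw [gridProj_inl_injective h]
  · exact absurd hi (w'.2.2.trans (show 4 < 5 by norm_num)).ne'
  · exact absurd hi w'.2.2.ne'
  · exact absurd hi (w.2.2.trans (show 4 < 5 by norm_num)).ne
  · simp only [gridProj, Prod.mk.injEq, and_true] at h
    rw [Prod.ext (Subtype.ext h) (Fin.ext hi)]
  · simp only [gridProj, Prod.mk.injEq, and_true] at h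
    have h1 := w.1.2
    have h2 := w'.1.2
    omega
  · exact absurd hi w.2.2.ne
  · simp only [gridProj, Prod.mk.injEq, and_true] at h
    have h1 := w.1.2
    have h2 := w'.1.2
    omega
  · simp only [gridProj, Prod.mk.injEq, and_true] at h
    rw [Prod.ext (Subtype.ext h) (Fin.ext hi)]

lemma gadgetIndex_lt_two_of_adj {p : ℤ × ℤ} (hp : 0 ≤ p.1) {x y : GV} (hx : x ∈ Gadget p)
    (hy : y ∈ Gadget p) (hadj : GraphG.Adj x y) : gadgetIndex x < 2 ∨ gadgetIndex y < 2 := by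
  obtain ⟨hx, hx'⟩ := hx
  obtain ⟨hy, hy'⟩ := hy
  have h := ((SimpleGraph.fromRel_adj _ _ _).mp hadj).2
  rcases x with q | w | w
  · exact absurd rfl (hx' q)
  · have := w.1.2
    rw [← hx] at hp
    simp only [gridProj] at hp
    omega
  · rcases y with q | w' | w'
    · exact absurd rfl (hy' q)
    · have := w'.1.2
      rw [← hy] at hp
      simp only [gridProj] at hp
      omega
    · exact h.imp (fun h => h.2.1) (fun h => h.2.1)

/-- A set of branch sets inside of a gadget with at most `n` vertices has at most `n` members. -/
lemma IsMinorModel.card_le_of_subset_gadget {α : Type*} {X : SimpleGraph α} {B : α → Set GV}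
    (hB : IsMinorModel X GraphG B) {p : ℤ × ℤ} (Q : Finset α) (hQ : ∀ v ∈ Q, B v ⊆ Gadget p)
    (n : ℕ) (hn : ∀ x ∈ Gadget p, gadgetIndex x < n) : Q.card ≤ n := by
  choose b hb using hB.nonempty
  rw [← Finset.card_range n]
  refine Finset.card_le_card_of_injOn (fun v => gadgetIndex (b v)) ?_ ?_
  · intro v hv
    exact Finset.mem_coe.mpr (Finset.mem_range.mpr (hn _ (hQ v hv (hb v))))
  · intro u hu v hv h
    have := eq_of_gridProj_of_gadgetIndex ((hQ u hu (hb u)).1.trans (hQ v hv (hb v)).1.symm) h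
    exact hB.eq_of_mem (hb u) (this ▸ hb v)

/-- Four pairwise adjacent branch sets do not fit into the gadget of a `K₃,₃`. -/
lemma IsMinorModel.gadget_neg_of_clique {B : Fin 5 → Set GV} (hB : IsMinorModel K5 GraphG B)
    {p : ℤ × ℤ} (q : Fin 5) (hq : ∀ v, v ≠ q → B v ⊆ Gadget p) : p.1 < 0 := by
  classical
  by_contra! hp
  have hrep : ∀ v, ∃ x ∈ B v, (∃ y ∈ B v, gadgetIndex y < 2) → gadgetIndex x < 2 := by
    intro v
    by_cases h : ∃ y ∈ B v, gadgetIndex y < 2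
    · obtain ⟨y, hy, hy2⟩ := h
      exact ⟨y, hy, fun _ => hy2⟩
    · obtain ⟨y, hy⟩ := hB.nonempty v
      exact ⟨y, hy, fun h' => absurd h' h⟩
  choose b hb hb2 using hrep
  obtain ⟨u, hu, v, hv, huv, h⟩ := Finset.exists_ne_map_eq_of_card_lt_of_maps_to
    (s := Finset.univ.erase q) (t := Finset.range 3) (by simp)
    (f := fun v => min (gadgetIndex (b v)) 2) (fun v _ => by simp)
  have hu' := hq u (Finset.ne_of_mem_erase hu)
  have hv' := hq v (Finset.ne_of_mem_erase hv)
  obtain ⟨x, hx, y, hy, hadj⟩ := hB.adj (v := u) (w := v) huv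
  have hlt : gadgetIndex (b u) < 2 ∨ gadgetIndex (b v) < 2 :=
    (gadgetIndex_lt_two_of_adj hp (hu' hx) (hv' hy) hadj).imp (fun h => hb2 u ⟨x, hx, h⟩)
      (fun h => hb2 v ⟨y, hy, h⟩)
  have heq : gadgetIndex (b u) = gadgetIndex (b v) := by
    omega
  have := eq_of_gridProj_of_gadgetIndex ((hu' (hb u)).1.trans (hv' (hb v)).1.symm) heq
  exact huv (hB.eq_of_mem (hb u) (this ▸ hb v))

lemma snd_eq_zero_of_mem_gadget {p : ℤ × ℤ} {x : GV} (hx : x ∈ Gadget p) : p.2 = 0 := by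
  obtain ⟨rfl, h⟩ := hx
  rcases x with q | w | w
  · exact absurd rfl (h q)
  · rfl
  · rfl

/-- Every `K₅`-model contains an attachment vertex of a `K₅`. -/
lemma IsMinorModel.exists_neg_mem {B : Fin 5 → Set GV} (hB : IsMinorModel K5 GraphG B) :
    ∃ a : ℤ, a < 0 ∧ ∃ v, Sum.inl (a, 0) ∈ B v := by
  have hgrid : ¬ ∀ v, ∃ q, Sum.inl q ∈ B v := by
    intro hgrid
    obtain ⟨F, l, r, hlift, hcut⟩ := hB.exists_dual hgrid k5Src k5Tgt (by decide) (by decide)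
    exact k5_no_dual l r hlift hcut
  push Not at hgrid
  obtain ⟨v, hv⟩ := hgrid
  obtain ⟨p, hp⟩ := (hB.propagates v).exists_subset_gadget (hB.nonempty v) (by push Not; exact hv)
  have hstep : ∀ u, p ∉ gridTrace (B u) → B u ⊆ Gadget p := by
    intro u hu
    by_cases huv : v = u
    · exact huv ▸ hp
    · exact hB.subset_gadget_of_adj (v := v) huv hp hu
  obtain ⟨q, hq⟩ := hB.exists_unique_trace p
  have hneg := hB.gadget_neg_of_clique q fun u hu => hstep u (hq u hu)
  by_contra! hcon
  have hcard := hB.card_le_of_subset_gadget Finset.univ (p := p) ?_ 4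
    fun x hx => gadgetIndex_lt_of_neg hx hneg
  · simp at hcard
  · refine fun u _ => hstep u ?_
    rintro ⟨⟨a, n⟩, hmem, rfl⟩
    obtain ⟨x, hx⟩ := hB.nonempty v
    have h0 : ((n : ℕ) : ℤ) = 0 := snd_eq_zero_of_mem_gadget (hp hx)
    obtain rfl : n = 0 := by exact_mod_cast h0
    exact hcon a hneg u hmem

/-- Every `K₃,₃`-model contains an attachment vertex of a `K₃,₃`. -/
lemma IsMinorModel.exists_nonneg_mem {B : Fin 3 ⊕ Fin 3 → Set GV}
    (hB : IsMinorModel K33 GraphG B) : ∃ b : ℤ, 0 ≤ b ∧ ∃ v, Sum.inl (b, 0) ∈ B v := by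
  have hgrid : ¬ ∀ v, ∃ q, Sum.inl q ∈ B v := by
    intro hgrid
    obtain ⟨F, l, r, hlift, hcut⟩ := hB.exists_dual hgrid k33Src k33Tgt
      (by simp [k33Src, k33Tgt]) (by decide)
    exact k33_no_dual l r hlift hcut
  push Not at hgrid
  obtain ⟨v, hv⟩ := hgrid
  obtain ⟨p, hp⟩ := (hB.propagates v).exists_subset_gadget (hB.nonempty v) (by push Not; exact hv)
  obtain ⟨q, hq⟩ := hB.exists_unique_trace p
  have hpath : ∀ v u q : Fin 3 ⊕ Fin 3, v ≠ u → K33.Adj v u ∨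
      ∃ m, m ≠ q ∧ K33.Adj v m ∧ K33.Adj m u := by
    simp only [K33, completeBipartiteGraph_adj]
    decide
  have hstep : ∀ u, p ∉ gridTrace (B u) → B u ⊆ Gadget p := by
    intro u hu
    by_cases huv : v = u
    · exact huv ▸ hp
    · rcases hpath v u q huv with h | ⟨m, hm, h1, h2⟩
      · exact hB.subset_gadget_of_adj h hp hu
      · exact hB.subset_gadget_of_adj h2 (hB.subset_gadget_of_adj h1 hp (hq m hm)) hu
  have hnonneg : 0 ≤ p.1 := by
    by_contra! hneg
    have hcard := hB.card_le_of_subset_gadget (Finset.univ.erase q) (p := p)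
      (fun u hu => hstep u (hq u (Finset.ne_of_mem_erase hu))) 4
      fun x hx => gadgetIndex_lt_of_neg hx hneg
    simp at hcard
  by_contra! hcon
  have hcard := hB.card_le_of_subset_gadget Finset.univ (p := p) ?_ 5 fun x hx => gadgetIndex_lt hx
  · simp at hcard
  · refine fun u _ => hstep u ?_
    rintro ⟨⟨a, n⟩, hmem, rfl⟩
    obtain ⟨x, hx⟩ := hB.nonempty v
    have h0 : ((n : ℕ) : ℤ) = 0 := snd_eq_zero_of_mem_gadget (hp hx)
    obtain rfl : n = 0 := by exact_mod_cast h0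
    exact hcon a hnonneg u hmem

/-! ### Separation by arcs of the half-grid -/

lemma gridProj_snd_nonneg (x : GV) : 0 ≤ (gridProj x).2 := by
  rcases x with p | w | w
  · exact Int.natCast_nonneg _
  · exact le_rfl
  · exact le_rfl

lemma snd_nonneg_of_mem_gridTrace {S : Set GV} {p : ℤ × ℤ} (h : p ∈ gridTrace S) : 0 ≤ p.2 := by
  obtain ⟨q, _, rfl⟩ := h
  exact gridProj_snd_nonneg _

/-- A set of vertices whose projection to the grid is finite is finite. -/
lemma finite_of_gridProj_mem {S : Set GV} {T : Set (ℤ × ℤ)} (hT : T.Finite)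
    (h : ∀ x ∈ S, gridProj x ∈ T) : S.Finite := by
  refine Set.Finite.of_finite_image (f := fun x => (gridProj x, gadgetIndex x))
    ((hT.prod (Set.finite_Iic 5)).subset ?_) ?_
  · rintro _ ⟨x, hx, rfl⟩
    exact ⟨h x hx, gadgetIndex_le x⟩
  · intro x _ y _ hxy
    exact eq_of_gridProj_of_gadgetIndex (congrArg Prod.fst hxy) (congrArg Prod.snd hxy)

lemma chainEval_congr {c : GridEdge →₀ ZMod 2} {f f' : GridEdge → ZMod 2}
    (h : ∀ g, c g ≠ 0 → f g = f' g) : chainEval f c = chainEval f' c := by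
  rw [chainEval, chainEval, Finsupp.linearCombination_apply, Finsupp.linearCombination_apply]
  exact Finset.sum_congr rfl fun g hg => by
    simp only [h g (Finsupp.mem_support_iff.mp hg)]

lemma finite_edgesAbove_ne_zero (c : GridEdge →₀ ZMod 2) :
    {p : ℤ × ℤ | 0 ≤ p.2 ∧ edgesAbove c p ≠ 0}.Finite := by
  classical
  refine (c.support.biUnion fun g => {g.src.1} ×ˢ Finset.Icc 0 g.src.2).finite_toSet.subset ?_
  rintro p ⟨hp, h⟩
  by_contra hcon
  apply h
  rw [edgesAbove, chainEval_congr (f' := fun _ => 0), chainEval, Finsupp.linearCombination_apply]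
  · simp
  · rintro (⟨i, j⟩ | ⟨i, j⟩) hg
    · refine if_neg ?_
      rintro ⟨rfl, hj⟩
      refine hcon (Finset.mem_coe.mpr (Finset.mem_biUnion.mpr
        ⟨_, Finsupp.mem_support_iff.mpr hg, ?_⟩))
      simp [src, hp, hj.le]
    · rfl

/-- An arc of the half-grid with both ends on the bottom row separates the points below it from
infinity. -/
lemma finite_of_below_arc {U S : Set GV} (hU : Propagates GraphG U) (hS : Propagates GraphG S)
    (hdisj : Disjoint U S) {a b x : ℤ} {y : ℕ} (ha : Sum.inl (a, 0) ∈ U)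
    (hb : Sum.inl (b, 0) ∈ U) (hax : a ≤ x) (hxb : x < b) (hxy : Sum.inl (x, y) ∈ S)
    (hcol : ∀ j ≤ y, Sum.inl (x, j) ∉ U) : S.Finite := by
  obtain ⟨c, hc, hcU⟩ := hU.exists_chain ha hb
  have hcS : ∀ g : GridEdge, g.src ∈ gridTrace S → c g = 0 := by
    intro g hg
    by_contra h
    exact gridTrace_disjoint hdisj (hcU g h).1 hg
  have hstart : edgesAbove c (gridProj (Sum.inl (x, y))) = 1 := by
    have h := hc (fun r => if r.1 ≤ x then 1 else 0)
    simp only [gridProj, hax, hxb.not_ge, if_true, if_false, add_zero] at h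
    rw [← h, edgesAbove]
    refine chainEval_congr ?_
    rintro (⟨i, j⟩ | ⟨i, j⟩) hg
    · obtain ⟨⟨q, hqU, hq⟩, -⟩ := hcU _ hg
      simp only [gridProj, src, Prod.mk.injEq] at hq
      have hj : i = x → (y : ℤ) < j := by
        intro hi
        by_contra! hj
        refine hcol q.2 (by omega) ?_
        rwa [← hi, ← hq.1]
      simp only [cobdry, src, tgt, gridProj]
      rcases lt_trichotomy i x with h | h | h
      · simp [h.ne, h.le, show i + 1 ≤ x by omega, CharTwo.add_self_eq_zero]
      · simp [h, hj h]
      · simp [h.ne', h.not_ge, show ¬ i + 1 ≤ x by omega]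
    · exact (CharTwo.add_self_eq_zero _).symm
  have hedge : ∀ g : GridEdge, g.src ∈ gridTrace S → g.tgt ∈ gridTrace S →
      edgesAbove c g.src = edgesAbove c g.tgt := by
    rintro (⟨i, j⟩ | ⟨i, j⟩) hs ht
    · have h := hc.ver_eq_edgesAbove (i + 1) j
      have hj : 0 ≤ j := snd_nonneg_of_mem_gridTrace hs
      rw [hcS (ver (i + 1) j) ht] at h
      simp only [gridProj, Nat.cast_zero, hj.not_gt, and_false, if_false, add_zero,
        add_sub_cancel_right] at h
      exact (CharTwo.add_eq_zero.mp h.symm).symm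
    · have h := hor_eq_edgesAbove c i (j + 1)
      rw [hcS (hor i (j + 1)) ht, add_sub_cancel_right] at h
      exact (CharTwo.add_eq_zero.mp h.symm).symm
  have hall : ∀ z ∈ S, edgesAbove c (gridProj z) = 1 := by
    refine hS _ ⟨_, hxy, hstart⟩ ?_
    intro z hz z' hz' hadj hPz
    have h1 := hS.gridProj_mem ⟨_, hxy⟩ hz
    have h2 := hS.gridProj_mem ⟨_, hxy⟩ hz'
    rcases adj_gridProj hadj with h | ⟨_, _, _, _, g, ⟨hs, ht⟩ | ⟨hs, ht⟩⟩
    · rwa [← h]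
    · rw [← ht, ← hedge g (hs ▸ h1) (ht ▸ h2), hs, hPz]
    · rw [← hs, hedge g (hs ▸ h2) (ht ▸ h1), ht, hPz]
  refine finite_of_gridProj_mem (finite_edgesAbove_ne_zero c) fun z hz =>
    ⟨gridProj_snd_nonneg z, ?_⟩
  rw [hall z hz]
  exact one_ne_zero

lemma graphI_propagates : Propagates GraphI Set.univ := by
  rintro P ⟨v, -, hv⟩ hstep
  replace hstep : ∀ u v, GraphI.Adj u v → P u → P v := fun u v => hstep u trivial v trivial
  have hK5 : ∀ i j : Fin 5, i ≠ j → GraphI.Adj (Sum.inl i) (Sum.inl j) := fun i j hij =>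
    ⟨by simpa using hij, Or.inl trivial⟩
  have hcut : ∀ j : Fin 3, GraphI.Adj (Sum.inl 0) (Sum.inr (Sum.inr j)) := fun j =>
    ⟨by simp, Or.inl rfl⟩
  have hK33 : ∀ (i : Fin 2) (j : Fin 3),
      GraphI.Adj (Sum.inr (Sum.inl i)) (Sum.inr (Sum.inr j)) := fun i j =>
    ⟨by simp, Or.inl trivial⟩
  have h0 : P (Sum.inl 0) := by
    rcases v with i | i | j
    · by_cases hi : i = 0
      · exact hi ▸ hv
      · exact hstep _ _ (hK5 i 0 hi) hv
    · exact hstep _ _ (hcut 0).symm (hstep _ _ (hK33 i 0) hv)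
    · exact hstep _ _ (hcut j).symm hv
  rintro (i | i | j) -
  · by_cases hi : i = 0
    · exact hi ▸ h0
    · exact hstep _ _ (hK5 0 i (Ne.symm hi)) h0
  · exact hstep _ _ (hK33 i 0).symm (hstep _ _ (hcut 0) h0)
  · exact hstep _ _ (hcut j) h0

lemma ray_propagates : Propagates Ray Set.univ := by
  rintro P ⟨n, -, hn⟩ hstep
  replace hstep : ∀ u v, Ray.Adj u v → P u → P v := fun u v => hstep u trivial v trivial
  have hadj : ∀ k, Ray.Adj k (k + 1) := fun k => ⟨by simp, Or.inl rfl⟩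
  have h0 : P 0 := by
    induction n with
    | zero => exact hn
    | succ k ih => exact ih (hstep _ _ (hadj k).symm hn)
  rintro m -
  induction m with
  | zero => exact h0
  | succ k ih => exact hstep _ _ (hadj k) ih

/-- The inclusion of `K₃,₃` into `GraphI`. -/
def k33ToI : Fin 3 ⊕ Fin 3 → IV :=
  Sum.elim ![Sum.inl 0, Sum.inr (Sum.inl 0), Sum.inr (Sum.inl 1)] fun j => Sum.inr (Sum.inr j)

lemma k33ToI_adj (i j : Fin 3) : GraphI.Adj (k33ToI (Sum.inl i)) (k33ToI (Sum.inr j)) := by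
  fin_cases i
  · exact ⟨by simp [k33ToI], Or.inl rfl⟩
  · exact ⟨by simp [k33ToI], Or.inl trivial⟩
  · exact ⟨by simp [k33ToI], Or.inl trivial⟩

/-- Every model of `GraphI` contains attachment vertices of both kinds. -/
lemma IsMinorModel.exists_attachments {B : IV → Set GV} (hB : IsMinorModel GraphI GraphG B) :
    ∃ a b : ℤ, a < 0 ∧ 0 ≤ b ∧ Sum.inl (a, 0) ∈ ⋃ v, B v ∧ Sum.inl (b, 0) ∈ ⋃ v, B v := by
  have h5 : IsMinorModel K5 GraphG (B ∘ Sum.inl) := hB.comp Sum.inl Sum.inl_injective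
    fun i j hij => ⟨by simpa using hij, Or.inl trivial⟩
  have h33 : IsMinorModel K33 GraphG (B ∘ k33ToI) := by
    refine hB.comp k33ToI (by decide) ?_
    rintro (i | i) (j | j) hij
    · simp at hij
    · exact k33ToI_adj i j
    · exact (k33ToI_adj j i).symm
    · simp at hij
  obtain ⟨a, ha, u, hu⟩ := h5.exists_neg_mem
  obtain ⟨b, hb, v, hv⟩ := h33.exists_nonneg_mem
  exact ⟨a, b, ha, hb, Set.mem_iUnion_of_mem _ hu, Set.mem_iUnion_of_mem _ hv⟩

/-- Some member with positive index of a disjoint sequence of sets avoids a given finite set. -/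
lemma exists_pos_disjoint_of_finite {β : Type*} {U : ℕ → Set β}
    (hU : ∀ k l, k ≠ l → Disjoint (U k) (U l)) {T : Set β} (hT : T.Finite) :
    ∃ k, k ≠ 0 ∧ ∀ x ∈ T, x ∉ U k := by
  by_contra! h
  choose f hfT hfU using fun k : ℕ => h (k + 1) k.succ_ne_zero
  have hinj : Function.Injective f := by
    intro k l hkl
    by_contra hne
    exact Set.disjoint_left.mp (hU (k + 1) (l + 1) (by simpa using hne)) (hfU k) (hkl ▸ hfU l)
  exact Set.infinite_range_of_injective hinj (hT.subset (Set.range_subset_iff.mpr hfT))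

/-- The graph `G` does not contain infinitely many pairwise vertex-disjoint
`H`-minors. -/
theorem statement2 :
    ¬ ∃ B : ℕ → (IV ⊕ ℕ) → Set GV, DisjointModels GraphH GraphG B := by
  rintro ⟨B, hB, hdisj⟩
  have hI : ∀ k, IsMinorModel GraphI GraphG (B k ∘ Sum.inl) := fun k =>
    (hB k).comp Sum.inl Sum.inl_injective fun _ _ h => h
  have hR : IsMinorModel Ray GraphG (B 0 ∘ Sum.inr) :=
    (hB 0).comp Sum.inr Sum.inr_injective fun _ _ h => h
  set U : ℕ → Set GV := fun k => ⋃ v, (B k ∘ Sum.inl) v with hU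
  set S : Set GV := ⋃ n, (B 0 ∘ Sum.inr) n with hS
  have hUsub : ∀ k, U k ⊆ ⋃ v, B k v := fun k =>
    Set.iUnion_subset fun v => Set.subset_iUnion (B k) (Sum.inl v)
  have hSsub : S ⊆ ⋃ v, B 0 v :=
    Set.iUnion_subset fun n => Set.subset_iUnion (B 0) (Sum.inr n)
  have hUconn : ∀ k, Propagates GraphG (U k) := fun k =>
    (hI k).propagates_iUnion graphI_propagates
  have hSconn : Propagates GraphG S := hR.propagates_iUnion ray_propagates
  have hSinf : ¬ S.Finite := by
    choose f hf using hR.nonempty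
    have hinj : Function.Injective f := fun m n hmn => hR.eq_of_mem (hf m) (hmn ▸ hf n)
    exact fun h => Set.infinite_range_of_injective hinj
      (h.subset (Set.range_subset_iff.mpr fun n => Set.mem_iUnion_of_mem n (hf n)))
  obtain ⟨⟨x, y⟩, hxy⟩ : ∃ q, Sum.inl q ∈ S := by
    by_contra h
    obtain ⟨z, hz⟩ := hR.nonempty 0
    obtain ⟨p, hp⟩ := hSconn.exists_subset_gadget ⟨z, Set.mem_iUnion_of_mem 0 hz⟩ h
    exact hSinf (finite_of_gridProj_mem (Set.finite_singleton p) fun z hz => (hp hz).1)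
  have hT : (Sum.inl '' (Set.Icc (-|x|) |x| ×ˢ Set.Iic y) : Set GV).Finite :=
    ((Set.finite_Icc _ _).prod (Set.finite_Iic y)).image _
  obtain ⟨k, hk, hkT⟩ := exists_pos_disjoint_of_finite
    (fun k l hkl => (hdisj hkl).mono (hUsub k) (hUsub l)) hT
  have havoid : ∀ i : ℤ, -|x| ≤ i → i ≤ |x| → ∀ j ≤ y, Sum.inl (i, j) ∉ U k :=
    fun i h1 h2 j hj => hkT _ ⟨(i, j), ⟨⟨h1, h2⟩, hj⟩, rfl⟩
  obtain ⟨a, b, ha, hb, haU, hbU⟩ := (hI k).exists_attachments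
  have hx1 := neg_abs_le x
  have hx2 := le_abs_self x
  have hax : a ≤ x := by
    by_contra! h
    exact havoid a (by omega) (by omega) 0 (Nat.zero_le y) haU
  have hxb : x < b := by
    by_contra! h
    exact havoid b (by omega) (by omega) 0 (Nat.zero_le y) hbU
  exact hSinf (finite_of_below_arc (hUconn k) hSconn ((hdisj hk).mono (hUsub k) hSsub) haU hbU
    hax hxb hxy (havoid x hx1 hx2))
end

section
/- For every finite set S of vertices of the graph G, the unique infinite component of G − S contains infinitely many pairwise vertex-disjoint rays. -/
open SimpleGraph

/-- The `ℓ¹`-size of the half-grid vertex at which a vertex of `G` is located. -/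
def GV.size : GV → ℕ
  | Sum.inl p => p.1.natAbs + p.2
  | Sum.inr (Sum.inl w) => w.1.1.natAbs
  | Sum.inr (Sum.inr w) => w.1.1.natAbs

/-- Only finitely many vertices of `G` have bounded size. -/
lemma GV.finite_size_lt (N : ℕ) : {x : GV | x.size < N}.Finite := by
  have hI : (Set.Ioo (-(N : ℤ)) N).Finite := Set.finite_Ioo _ _
  have h₁ := hI.prod (Set.finite_Iio N)
  have h₂ := (hI.preimage (f := fun a : NegInt => a.1)
    Subtype.val_injective.injOn).prod (Set.finite_univ (α := Fin 4))
  have h₃ := (hI.preimage (f := fun a : NonnegInt => a.1)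
    Subtype.val_injective.injOn).prod (Set.finite_univ (α := Fin 5))
  refine ((h₁.image Sum.inl).union (((h₂.image Sum.inl).union
    (h₃.image Sum.inr)).image Sum.inr)).subset ?_
  rintro (⟨a, h⟩ | ⟨⟨a, ha⟩, i⟩ | ⟨⟨a, ha⟩, i⟩) hx <;>
    simp only [Set.mem_ofPred_eq, GV.size] at hx <;> simp <;> omega

lemma GraphG.adj_up (a : ℤ) (h : ℕ) :
    GraphG.Adj (Sum.inl (a, h)) (Sum.inl (a, h + 1)) := by
  simp [GraphG, GRel, GridRel]

lemma GraphG.adj_right (a : ℤ) (h : ℕ) :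
    GraphG.Adj (Sum.inl (a, h)) (Sum.inl (a + 1, h)) := by
  simp [GraphG, GRel, GridRel]

section Avoiding

variable {S : Set GV} {N : ℕ}

lemma reachable_column_base {a : ℤ} (hcol : ∀ h, (Sum.inl (a, h) : GV) ∈ Sᶜ) (h : ℕ) :
    (GraphG.induce Sᶜ).Reachable ⟨_, hcol h⟩ ⟨_, hcol 0⟩ := by
  induction h with
  | zero => rfl
  | succ h ih =>
    have hadj : (GraphG.induce Sᶜ).Adj ⟨_, hcol (h + 1)⟩ ⟨_, hcol h⟩ :=
      (GraphG.adj_up a h).symm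
    exact hadj.reachable.trans ih

lemma reachable_row {h : ℕ} (hrow : ∀ a, (Sum.inl (a, h) : GV) ∈ Sᶜ) (a b : ℤ) :
    (GraphG.induce Sᶜ).Reachable ⟨_, hrow a⟩ ⟨_, hrow b⟩ := by
  have hadj (c : ℤ) : (GraphG.induce Sᶜ).Adj ⟨_, hrow c⟩ ⟨_, hrow (c + 1)⟩ :=
    GraphG.adj_right c h
  induction a using Int.inductionOn' (b := b) with
  | zero => rfl
  | succ k _ ih => exact (hadj k).symm.reachable.trans ih
  | pred k _ ih =>
    have hk := hadj (k - 1)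
    simp only [sub_add_cancel] at hk
    exact hk.reachable.trans ih

lemma mem_compl_of_le_size (hN : ∀ x ∈ S, x.size < N) {x : GV} (hx : N ≤ x.size) :
    x ∈ Sᶜ :=
  fun h => (hN x h).not_ge hx

lemma inl_mem_compl (hN : ∀ x ∈ S, x.size < N) {a : ℤ} {h : ℕ}
    (hx : N ≤ a.natAbs ∨ N ≤ h) : (Sum.inl (a, h) : GV) ∈ Sᶜ :=
  mem_compl_of_le_size hN (by simp only [GV.size]; omega)

/-- If `S` lies in the ball of radius `N`, then all half-grid vertices in a column or row
avoiding that ball lie in one component of `G − S`. -/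
lemma reachable_inl (hN : ∀ x ∈ S, x.size < N) {a : ℤ} {h : ℕ}
    (hx : N ≤ a.natAbs ∨ N ≤ h) :
    (GraphG.induce Sᶜ).Reachable ⟨_, inl_mem_compl hN hx⟩
      ⟨Sum.inl ((N : ℤ), N), inl_mem_compl hN (Or.inr le_rfl)⟩ := by
  have hcol {c : ℤ} (hc : N ≤ c.natAbs) (i : ℕ) := inl_mem_compl hN (h := i) (Or.inl hc)
  have hrow {i : ℕ} (hi : N ≤ i) (c : ℤ) := inl_mem_compl hN (a := c) (Or.inr hi)
  rcases hx with hx | hx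
  · exact ((reachable_column_base (hcol hx) h).trans
      (reachable_column_base (hcol hx) N).symm).trans (reachable_row (hrow le_rfl) a N)
  · have hc : N ≤ (N : ℤ).natAbs := by simp
    exact (reachable_row (hrow hx) a N).trans
      ((reachable_column_base (hcol hc) h).trans (reachable_column_base (hcol hc) N).symm)

/-- Every vertex far from the origin is in the same component of `G − S` as `(N, N)`. -/
lemma reachable_of_two_mul_le_size (hN : ∀ x ∈ S, x.size < N) {x : GV}
    (hx : 2 * N ≤ x.size) (hxS : x ∈ Sᶜ) :
    (GraphG.induce Sᶜ).Reachable ⟨x, hxS⟩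
      ⟨Sum.inl ((N : ℤ), N), inl_mem_compl hN (Or.inr le_rfl)⟩ := by
  rcases x with ⟨a, h⟩ | ⟨a, i⟩ | ⟨b, i⟩ <;> simp only [GV.size] at hx
  · exact reachable_inl hN (by omega)
  · have ha : N ≤ a.1.natAbs ∨ N ≤ 0 := by omega
    have hadj : (GraphG.induce Sᶜ).Adj ⟨_, hxS⟩ ⟨_, inl_mem_compl hN ha⟩ := by
      simp [GraphG, GRel]
    exact hadj.reachable.trans (reachable_inl hN ha)
  · have hb : N ≤ b.1.natAbs ∨ N ≤ 0 := by omega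
    have hright (j : Fin 5) (hj : 2 ≤ (j : ℕ)) (hjS : Sum.inr (Sum.inr (b, j)) ∈ Sᶜ) :
        (GraphG.induce Sᶜ).Reachable ⟨_, hjS⟩
          ⟨Sum.inl ((N : ℤ), N), inl_mem_compl hN (Or.inr le_rfl)⟩ := by
      have hadj : (GraphG.induce Sᶜ).Adj ⟨_, hjS⟩ ⟨_, inl_mem_compl hN hb⟩ := by
        simp [GraphG, GRel, hj]
      exact hadj.reachable.trans (reachable_inl hN hb)
    by_cases hi : 2 ≤ (i : ℕ)
    · exact hright i hi hxS
    · have h2S : (Sum.inr (Sum.inr (b, 2)) : GV) ∈ Sᶜ :=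
        mem_compl_of_le_size hN (by simp only [GV.size]; omega)
      have hadj : (GraphG.induce Sᶜ).Adj ⟨_, hxS⟩ ⟨_, h2S⟩ := by
        have hne : i ≠ 2 := by rintro rfl; exact hi le_rfl
        have hlt : (i : ℕ) < 2 := by omega
        simp [GraphG, GRel, hne, hlt]
      exact hadj.reachable.trans (hright 2 le_rfl h2S)

end Avoiding

/-- For every finite set `S` of vertices of `G`, the (unique) infinite
component of `G − S` contains infinitely many pairwise vertex-disjoint rays. -/
theorem statement10 (S : Set GV) (hS : S.Finite)
    (C : (GraphG.induce Sᶜ).ConnectedComponent) (hC : C.supp.Infinite) :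
    ∃ f : ℕ → ℕ → (Sᶜ : Set GV),
      (∀ k : ℕ, (∀ n, f k n ∈ C.supp) ∧ Function.Injective (f k) ∧
        ∀ n, (GraphG.induce Sᶜ).Adj (f k n) (f k (n + 1))) ∧
      ∀ ⦃k l : ℕ⦄, k ≠ l → Disjoint (Set.range (f k)) (Set.range (f l)) := by
  obtain ⟨N, hN⟩ : ∃ N, ∀ x ∈ S, x.size < N := by
    obtain ⟨M, hM⟩ := (hS.image GV.size).bddAbove
    exact ⟨M + 1, fun x hx => Nat.lt_succ_of_le (hM (Set.mem_image_of_mem _ hx))⟩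
  obtain ⟨y, hyC, hy⟩ : ∃ y ∈ C.supp, 2 * N ≤ y.1.size := by
    by_contra! hlt
    exact hC (((GV.finite_size_lt (2 * N)).preimage Subtype.val_injective.injOn).subset hlt)
  have hfar (k : ℕ) : N ≤ ((N + k : ℕ) : ℤ).natAbs := by omega
  refine ⟨fun k n => ⟨Sum.inl (((N + k : ℕ) : ℤ), n), inl_mem_compl hN (Or.inl (hfar k))⟩,
    fun k => ⟨fun n => ?_, fun m n hmn => ?_, fun n => GraphG.adj_up _ n⟩, fun k l hkl => ?_⟩
  · rw [ConnectedComponent.mem_supp_iff] at hyC ⊢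
    rw [← hyC, ConnectedComponent.eq]
    exact (reachable_inl hN (Or.inl (hfar k))).trans
      (reachable_of_two_mul_le_size hN hy y.2).symm
  · simpa using hmn
  · rw [Set.disjoint_left]
    rintro _ ⟨m, rfl⟩ ⟨n, hmn⟩
    simp at hmn
    omega
end

section
/- The half-grid contains no model of K₅ and no model of K₃,₃; that is, neither K₅ nor K₃,₃ is a minor of the half-grid. -/
open SimpleGraph

/-- Indicator, mod 2, of `p` preceding `q` in the lexicographic order. -/
def lexInd (p q : ℤ × ℕ) : ZMod 2 :=
  if p.1 < q.1 ∨ (p.1 = q.1 ∧ p.2 < q.2) then 1 else 0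

/-- Indicator of the grid edge `p p'` passing above `q`, after tilting the vertical line
through `q` so that it meets no other grid vertex. -/
def edgeAbove (p p' q : ℤ × ℕ) : ZMod 2 :=
  if p.2 = p'.2 ∧ q.1 = max p.1 p'.1 ∧ q.2 < p.2 then 1 else 0

/-- Indicator of the grid edge `p p'` passing below `q`, with the same tilting convention. -/
def edgeBelow (p p' q : ℤ × ℕ) : ZMod 2 :=
  if p.2 = p'.2 ∧ q.1 = min p.1 p'.1 ∧ p.2 < q.2 then 1 else 0

/-- The parity of the number of edges of a walk passing above `q`. -/
def walkAbove {a b : ℤ × ℕ} (w : HalfGrid.Walk a b) (q : ℤ × ℕ) : ZMod 2 :=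
  (w.darts.map fun d => edgeAbove d.fst d.snd q).sum

/-- The parity of the number of edges of a walk passing below `q`. -/
def walkBelow {a b : ℤ × ℕ} (w : HalfGrid.Walk a b) (q : ℤ × ℕ) : ZMod 2 :=
  (w.darts.map fun d => edgeBelow d.fst d.snd q).sum

theorem halfGrid_adj_iff {p q : ℤ × ℕ} :
    HalfGrid.Adj p q ↔ GridRel p q ∨ GridRel q p := by
  simp only [HalfGrid, SimpleGraph.fromRel_adj, and_iff_right_iff_imp]
  rintro h rfl
  simp [GridRel] at h

theorem lexInd_add_lexInd_swap {p q : ℤ × ℕ} (h : p ≠ q) : lexInd p q + lexInd q p = 1 := by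
  obtain ⟨x, y⟩ := p
  obtain ⟨x', y'⟩ := q
  simp only [ne_eq, Prod.mk.injEq] at h
  unfold lexInd
  split_ifs <;> first | rfl | (exfalso; dsimp only at *; omega)

theorem lexInd_add_lexInd_of_adj {p p' q : ℤ × ℕ} (h : HalfGrid.Adj p p') (hp : p ≠ q)
    (hp' : p' ≠ q) :
    lexInd p q + lexInd p' q = edgeAbove p p' q + edgeBelow p p' q := by
  obtain ⟨x, y⟩ := p
  obtain ⟨x', y'⟩ := p'
  obtain ⟨z, t⟩ := q
  rw [halfGrid_adj_iff] at h
  simp only [ne_eq, Prod.mk.injEq, GridRel] at h hp hp'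
  unfold lexInd edgeAbove edgeBelow
  split_ifs <;> first | rfl | (exfalso; dsimp only at *; omega)

theorem edgeAbove_add_edgeAbove_of_adj {p p' q q' : ℤ × ℕ} (h : HalfGrid.Adj p p')
    (h' : HalfGrid.Adj q q') (h₁ : p ≠ q) (h₂ : p ≠ q') (h₃ : p' ≠ q) (h₄ : p' ≠ q') :
    edgeAbove p p' q + edgeAbove p p' q' = edgeBelow q q' p + edgeBelow q q' p' := by
  obtain ⟨x, y⟩ := p
  obtain ⟨x', y'⟩ := p'
  obtain ⟨z, t⟩ := q
  obtain ⟨z', t'⟩ := q'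
  rw [halfGrid_adj_iff] at h h'
  simp only [ne_eq, Prod.mk.injEq, GridRel] at h h' h₁ h₂ h₃ h₄
  unfold edgeAbove edgeBelow
  dsimp only
  rcases h with (⟨rfl, rfl⟩ | ⟨rfl, rfl⟩) | (⟨rfl, rfl⟩ | ⟨rfl, rfl⟩) <;>
    rcases h' with (⟨rfl, rfl⟩ | ⟨rfl, rfl⟩) | (⟨rfl, rfl⟩ | ⟨rfl, rfl⟩) <;>
    split_ifs <;> first | rfl | (exfalso; omega)

theorem lexInd_add_lexInd_of_walk {a b q : ℤ × ℕ} (w : HalfGrid.Walk a b)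
    (hq : q ∉ w.support) :
    lexInd a q + lexInd b q = walkAbove w q + walkBelow w q := by
  induction w with
  | nil => simp [walkAbove, walkBelow, CharTwo.add_self_eq_zero]
  | @cons u v w h p ih =>
    simp only [Walk.support_cons, List.mem_cons, not_or] at hq
    have hv : v ≠ q := fun e => hq.2 (e ▸ p.start_mem_support)
    have h₁ := lexInd_add_lexInd_of_adj h (Ne.symm hq.1) hv
    have h₂ := ih hq.2
    simp only [walkAbove, walkBelow, Walk.darts_cons, List.map_cons, List.sum_cons] at h₂ ⊢
    grind

theorem edgeAbove_add_edgeAbove_of_walk {p p' c d : ℤ × ℕ} (h : HalfGrid.Adj p p')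
    (w : HalfGrid.Walk c d) (hp : p ∉ w.support) (hp' : p' ∉ w.support) :
    edgeAbove p p' c + edgeAbove p p' d = walkBelow w p + walkBelow w p' := by
  induction w with
  | nil => simp [walkBelow, CharTwo.add_self_eq_zero]
  | @cons u v w h' r ih =>
    simp only [Walk.support_cons, List.mem_cons, not_or] at hp hp'
    have hv : p ≠ v := fun e => hp.2 (e ▸ r.start_mem_support)
    have hv' : p' ≠ v := fun e => hp'.2 (e ▸ r.start_mem_support)
    have h₁ := edgeAbove_add_edgeAbove_of_adj h h' hp.1 hv hp'.1 hv'
    have h₂ := ih hp.2 hp'.2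
    simp only [walkBelow, Walk.darts_cons, List.map_cons, List.sum_cons] at h₂ ⊢
    grind

theorem walkAbove_add_walkAbove_of_disjoint {a b c d : ℤ × ℕ} (w : HalfGrid.Walk a b)
    (w' : HalfGrid.Walk c d) (hd : ∀ x ∈ w.support, x ∉ w'.support) :
    walkAbove w c + walkAbove w d = walkBelow w' a + walkBelow w' b := by
  induction w with
  | nil => simp [walkAbove, CharTwo.add_self_eq_zero]
  | @cons u v w h p ih =>
    simp only [Walk.support_cons, List.mem_cons, forall_eq_or_imp] at hd
    have h₁ := edgeAbove_add_edgeAbove_of_walk h w' hd.1 (hd.2 _ p.start_mem_support)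
    have h₂ := ih hd.2
    simp only [walkAbove, Walk.darts_cons, List.map_cons, List.sum_cons] at h₂ ⊢
    grind

theorem exists_walk_of_induce_connected {V : Type*} {G : SimpleGraph V} {S : Set V}
    (h : (G.induce S).Connected) {a b : V} (ha : a ∈ S) (hb : b ∈ S) :
    ∃ w : G.Walk a b, ∀ x ∈ w.support, x ∈ S := by
  obtain ⟨w⟩ := h.preconnected ⟨a, ha⟩ ⟨b, hb⟩
  refine ⟨w.map (Embedding.induce S).toHom, fun x hx => ?_⟩
  obtain ⟨y, -, rfl⟩ := List.mem_map.1 ((Walk.support_map (Embedding.induce S).toHom w) ▸ hx)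
  exact y.2

/-- Vertices chosen in adjacent branch sets are joined by a walk inside their union. -/
theorem IsMinorModel.exists_walk {α β : Type*} {X : SimpleGraph α} {G : SimpleGraph β}
    {B : α → Set β} (h : IsMinorModel X G B) {r : α → β} (hr : ∀ i, r i ∈ B i) {i j : α}
    (hij : X.Adj i j) :
    ∃ w : G.Walk (r i) (r j), ∀ x ∈ w.support, x ∈ B i ∪ B j := by
  obtain ⟨x, hx, y, hy, hxy⟩ := h.adj hij
  obtain ⟨w₁, h₁⟩ := exists_walk_of_induce_connected (h.connected i) (hr i) hx
  obtain ⟨w₂, h₂⟩ := exists_walk_of_induce_connected (h.connected j) hy (hr j)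
  refine ⟨w₁.append (Walk.cons hxy w₂), fun z hz => ?_⟩
  rw [Walk.mem_support_append_iff, Walk.support_cons, List.mem_cons] at hz
  rcases hz with hz | rfl | hz
  · exact Or.inl (h₁ z hz)
  · exact Or.inl hx
  · exact Or.inr (h₂ z hz)

/-- The mod 2 data obstructing a minor model in the half-grid: `s` compares branch vertices
lexicographically and `A i j k` counts the edges of a walk from `i` to `j` above `k`. -/
theorem IsMinorModel.exists_cochain {α : Type*} {X : SimpleGraph α} {B : α → Set (ℤ × ℕ)}
    (h : IsMinorModel X HalfGrid B) :
    ∃ (s : α → α → ZMod 2) (A : α → α → α → ZMod 2),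
      (∀ i j, i ≠ j → s i j + s j i = 1) ∧
      ∀ i j k l, X.Adj i j → X.Adj k l → i ≠ k → i ≠ l → j ≠ k → j ≠ l →
        A i j k + A i j l + A k l i + A k l j = s k i + s l i + s k j + s l j := by
  classical
  choose r hr using h.nonempty
  choose P hP using fun (i j : α) (hij : X.Adj i j) => h.exists_walk hr hij
  have hdisj : ∀ {i j x}, i ≠ j → x ∈ B i → x ∉ B j := fun hij hi hj =>
    Set.disjoint_left.1 (h.pairwise_disjoint hij) hi hj
  refine ⟨fun i j => lexInd (r i) (r j),
    fun i j k => if hij : X.Adj i j then walkAbove (P i j hij) (r k) else 0,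
    fun i j hij => lexInd_add_lexInd_swap fun e => hdisj hij (hr i) (e ▸ hr j), ?_⟩
  intro i j k l hij hkl hik hil hjk hjl
  simp only [dif_pos hij, dif_pos hkl]
  have hi : r i ∉ (P k l hkl).support := fun hx =>
    (hP k l hkl _ hx).elim (hdisj hik (hr i)) (hdisj hil (hr i))
  have hj : r j ∉ (P k l hkl).support := fun hx =>
    (hP k l hkl _ hx).elim (hdisj hjk (hr j)) (hdisj hjl (hr j))
  have h₁ := lexInd_add_lexInd_of_walk _ hi
  have h₂ := lexInd_add_lexInd_of_walk _ hj
  have h₃ := walkAbove_add_walkAbove_of_disjoint (P i j hij) (P k l hkl) fun x hx hx' =>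
    (hP i j hij x hx).elim
      (fun hxi => (hP k l hkl x hx').elim (hdisj hik hxi) (hdisj hil hxi))
      (fun hxj => (hP k l hkl x hx').elim (hdisj hjk hxj) (hdisj hjl hxj))
  grind

theorem not_isMinorModel_K5 (B : Fin 5 → Set (ℤ × ℕ)) : ¬ IsMinorModel K5 HalfGrid B := by
  intro h
  obtain ⟨s, A, hs, hA⟩ := h.exists_cochain
  have key : ∀ a b c d : Fin 5, a < b → b < c → c < d →
      A a b c + A a b d + A c d a + A c d b + A a c b + A a c d + A b d a + A b d c +
        A a d b + A a d c + A b c a + A b c d = 1 := by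
    intro a b c d hab hbc hcd
    have hac := hab.trans hbc
    have hbd := hbc.trans hcd
    have had := hac.trans hcd
    have h₁ := hA a b c d hab.ne hcd.ne hac.ne had.ne hbc.ne hbd.ne
    have h₂ := hA a c b d hac.ne hbd.ne hab.ne had.ne hbc.ne' hcd.ne
    have h₃ := hA a d b c had.ne hbc.ne hab.ne hac.ne hbd.ne' hcd.ne'
    have e₁ := hs b c hbc.ne
    have e₂ := hs b d hbd.ne
    have e₃ := hs c d hcd.ne
    grind
  have k₀ := key 1 2 3 4 (by decide) (by decide) (by decide)
  have k₁ := key 0 2 3 4 (by decide) (by decide) (by decide)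
  have k₂ := key 0 1 3 4 (by decide) (by decide) (by decide)
  have k₃ := key 0 1 2 4 (by decide) (by decide) (by decide)
  have k₄ := key 0 1 2 3 (by decide) (by decide) (by decide)
  grind

theorem not_isMinorModel_K33 (B : Fin 3 ⊕ Fin 3 → Set (ℤ × ℕ)) :
    ¬ IsMinorModel K33 HalfGrid B := by
  intro h
  obtain ⟨s, A, hs, hA⟩ := h.exists_cochain
  obtain ⟨a, ha⟩ : ∃ a : Fin 3 → Fin 3 → Fin 3 ⊕ Fin 3 → ZMod 2,
      a = fun i j => A (Sum.inl i) (Sum.inr j) := ⟨_, rfl⟩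
  obtain ⟨t, ht⟩ : ∃ t : Fin 3 → Fin 3 → ZMod 2,
      t = fun i j => s (Sum.inl i) (Sum.inr j) := ⟨_, rfl⟩
  have key : ∀ i k j l : Fin 3, i ≠ k → j ≠ l →
      a i j (Sum.inl k) + a i j (Sum.inr l) + a k l (Sum.inl i) + a k l (Sum.inr j) +
        a i l (Sum.inl k) + a i l (Sum.inr j) + a k j (Sum.inl i) + a k j (Sum.inr l) =
        1 + t i j + t i l + t k j + t k l := by
    intro i k j l hik hjl
    have h₁ := hA (Sum.inl i) (Sum.inr j) (Sum.inl k) (Sum.inr l) (by simp) (by simp)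
      (by simpa using hik) (by simp) (by simp) (by simpa using hjl)
    have h₂ := hA (Sum.inl i) (Sum.inr l) (Sum.inl k) (Sum.inr j) (by simp) (by simp)
      (by simpa using hik) (by simp) (by simp) (by simpa using hjl.symm)
    have e₁ := hs (Sum.inl i) (Sum.inr j) (by simp)
    have e₂ := hs (Sum.inl i) (Sum.inr l) (by simp)
    have e₃ := hs (Sum.inr j) (Sum.inr l) (by simpa using hjl)
    subst ha ht
    grind
  have k₁ := key 0 1 0 1 (by decide) (by decide)
  have k₂ := key 0 1 0 2 (by decide) (by decide)
  have k₃ := key 0 1 1 2 (by decide) (by decide)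
  have k₄ := key 0 2 0 1 (by decide) (by decide)
  have k₅ := key 0 2 0 2 (by decide) (by decide)
  have k₆ := key 0 2 1 2 (by decide) (by decide)
  have k₇ := key 1 2 0 1 (by decide) (by decide)
  have k₈ := key 1 2 0 2 (by decide) (by decide)
  have k₉ := key 1 2 1 2 (by decide) (by decide)
  clear key ha ht hs hA
  grind

/-- The half-grid contains no model of `K₅` and no model of `K₃,₃`:
neither `K₅` nor `K₃,₃` is a minor of the half-grid. -/
theorem statement13 :
    (¬ ∃ B : Fin 5 → Set (ℤ × ℕ), IsMinorModel K5 HalfGrid B) ∧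
    (¬ ∃ B : Fin 3 ⊕ Fin 3 → Set (ℤ × ℕ), IsMinorModel K33 HalfGrid B) :=
  ⟨fun ⟨B, hB⟩ => not_isMinorModel_K5 B hB, fun ⟨B, hB⟩ => not_isMinorModel_K33 B hB⟩
end
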